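/- arXiv:1307.0439 — 3 statements merged into one kernel-verified Lean document; each statement's English description precedes it below -/
import Mathlib

section
/- Let G be a simply connected domain in ℂ and let J be a crosscut of G. Then J separates G into two pieces: there exist disjoint nonempty open connected simply connected sets U and V such that G \ J = U ∪ V. -/
open Set Topology Metric Filter

/-- A simply connected domain in `ℂ`: a nonempty open connected proper subset of `ℂ`
that is simply connected. -/
def IsSCDomain (G : Set ℂ) : Prop :=
  IsOpen G ∧ IsConnected G ∧ G ≠ Set.univ ∧ SimplyConnectedSpace G

/-- `J` is a Jordan arc with parametrization `f` on `[0,1]`. -/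
def IsJordanArcParam (J : Set ℂ) (f : ℝ → ℂ) : Prop :=
  ContinuousOn f (Set.Icc 0 1) ∧ Set.InjOn f (Set.Icc 0 1) ∧ J = f '' Set.Icc 0 1

/-- `J` is a Jordan arc: the image of an injective continuous map on `[0,1]`. -/
def IsJordanArc (J : Set ℂ) : Prop := ∃ f, IsJordanArcParam J f

/-- A crosscut of `G`: a Jordan arc whose two endpoints lie in `∂G` and which,
apart from its endpoints, is contained in `G`. -/
def IsCrosscut (G J : Set ℂ) : Prop :=
  ∃ f, IsJordanArcParam J f ∧ f 0 ∈ frontier G ∧ f 1 ∈ frontier G ∧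
    J \ {f 0, f 1} ⊆ G

/-- A domain: a nonempty open connected set. -/
def IsPlanarDomain (U : Set ℂ) : Prop := IsOpen U ∧ IsConnected U

/-- The set of accessible boundary points of `G`. -/
def accessiblePts (G : Set ℂ) : Set ℂ :=
  {b ∈ frontier G | ∃ J, IsJordanArc J ∧ J ⊆ closure G ∧ J ∩ frontier G = {b}}

/-- The set of non-accessible boundary points of `G`. -/
def nonAccessiblePts (G : Set ℂ) : Set ℂ := frontier G \ accessiblePts G

/-- `φ` is a Riemann map of `G`: analytic and injective on `G`, mapping `G` onto the
open unit disk. -/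
def IsRiemannMap (G : Set ℂ) (φ : ℂ → ℂ) : Prop :=
  AnalyticOnNhd ℂ φ G ∧ Set.InjOn φ G ∧ φ '' G = Metric.ball (0:ℂ) 1

/-- `Φ` is a continuous extension of `φ` to the closure of `G`. -/
def IsContExtension (G : Set ℂ) (φ Φ : ℂ → ℂ) : Prop :=
  ContinuousOn Φ (closure G) ∧ Set.EqOn Φ φ G

/-- The crosscut `J` separates `G` into the two disjoint domains `U` and `V`. -/
def IsCrosscutSep (G J U V : Set ℂ) : Prop :=
  IsCrosscut G J ∧ IsPlanarDomain U ∧ IsPlanarDomain V ∧ Disjoint U V ∧ G \ J = U ∪ V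

/-- `a` is a multiple boundary point of `G`. -/
def IsMultiplePt (G : Set ℂ) (a : ℂ) : Prop :=
  a ∈ frontier G ∧ ∃ J U V, IsCrosscutSep G J U V ∧ a ∈ (frontier U ∩ frontier V) \ J

/-- The set of multiple boundary points of `G`. -/
def multiplePts (G : Set ℂ) : Set ℂ := {a | IsMultiplePt G a}

/-- The set of prime boundary points of `G`. -/
def primePts (G : Set ℂ) : Set ℂ := frontier G \ multiplePts G

/-- The set of semi-accessible boundary points of `G`. -/
def semiAccessiblePts (G : Set ℂ) : Set ℂ :=
  {a ∈ frontier G | ∃ J U V, IsCrosscutSep G J U V ∧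
    a ∈ accessiblePts U ∩ nonAccessiblePts V}

/-- The set of multiple accessible boundary points of `G`. -/
def multipleAccessiblePts (G : Set ℂ) : Set ℂ :=
  {a ∈ frontier G | ∃ J U V, IsCrosscutSep G J U V ∧
    a ∈ (accessiblePts U ∩ accessiblePts V) \ J}

/-- The set of multiple unaccessible boundary points of `G`. -/
def multipleUnaccessiblePts (G : Set ℂ) : Set ℂ :=
  {a ∈ frontier G | ∃ J U V, IsCrosscutSep G J U V ∧
    a ∈ (nonAccessiblePts U ∩ nonAccessiblePts V) \ J}

/-- `Γ` is a Jordan curve: a homeomorphic image of the unit circle. -/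
def IsJordanCurve (Γ : Set ℂ) : Prop :=
  ∃ f : ℂ → ℂ, ContinuousOn f (Metric.sphere (0:ℂ) 1) ∧
    Set.InjOn f (Metric.sphere (0:ℂ) 1) ∧ Γ = f '' Metric.sphere (0:ℂ) 1

/-- A Jordan domain: a bounded connected component of the complement of a Jordan curve. -/
def IsJordanDomain (G : Set ℂ) : Prop :=
  Bornology.IsBounded G ∧ ∃ Γ, IsJordanCurve Γ ∧ ∃ x ∈ Γᶜ, G = connectedComponentIn Γᶜ x

/-- A Carathéodory domain: a simply connected domain whose boundary equals the boundary of
the unbounded component of the complement of the boundary. -/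
def IsCaratheodoryDomain (G : Set ℂ) : Prop :=
  IsSCDomain G ∧ ∃ x ∈ (frontier G)ᶜ,
    ¬ Bornology.IsBounded (connectedComponentIn (frontier G)ᶜ x) ∧
    frontier G = frontier (connectedComponentIn (frontier G)ᶜ x)

open scoped unitInterval

/-- `g` has a continuous logarithm on `S`. -/
def HasLogOn {X : Type*} [TopologicalSpace X] (g : X → ℂ) (S : Set X) : Prop :=
  ∃ l : X → ℂ, ContinuousOn l S ∧ ∀ z ∈ S, Complex.exp (l z) = g z

namespace HasLogOn

variable {X : Type*} [TopologicalSpace X] {g g' : X → ℂ} {S T : Set X}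

lemma mono (h : HasLogOn g T) (hST : S ⊆ T) : HasLogOn g S := by
  obtain ⟨l, hl, he⟩ := h
  exact ⟨l, hl.mono hST, fun z hz => he z (hST hz)⟩

lemma congr (h : HasLogOn g S) (hg : ∀ z ∈ S, g z = g' z) : HasLogOn g' S := by
  obtain ⟨l, hl, he⟩ := h
  exact ⟨l, hl, fun z hz => (he z hz).trans (hg z hz)⟩

lemma mul (h : HasLogOn g S) (h' : HasLogOn g' S) : HasLogOn (fun z => g z * g' z) S := by
  obtain ⟨l, hl, he⟩ := h
  obtain ⟨l', hl', he'⟩ := h'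
  exact ⟨fun z => l z + l' z, hl.add hl', fun z hz => by
    rw [Complex.exp_add, he z hz, he' z hz]⟩

lemma div (h : HasLogOn g S) (h' : HasLogOn g' S) : HasLogOn (fun z => g z / g' z) S := by
  obtain ⟨l, hl, he⟩ := h
  obtain ⟨l', hl', he'⟩ := h'
  exact ⟨fun z => l z - l' z, hl.sub hl', fun z hz => by
    rw [Complex.exp_sub, he z hz, he' z hz]⟩

end HasLogOn

lemma continuous_log_sub_const {X : Type*} [TopologicalSpace X] {S : Set X}
    (hS : IsPreconnected S) {l l' : X → ℂ} (hl : ContinuousOn l S) (hl' : ContinuousOn l' S)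
    (h : ∀ z ∈ S, Complex.exp (l z) = Complex.exp (l' z)) {x y : X} (hx : x ∈ S) (hy : y ∈ S) :
    l x - l' x = l y - l' y := by
  have : PreconnectedSpace S := Subtype.preconnectedSpace hS
  have key := Complex.isCoveringMap_exp.eq_of_comp_eq (A := S) (g₁ := fun z => l z)
    (g₂ := fun z => l' z + (l x - l' x)) (continuousOn_iff_continuous_domRestrict.mp hl)
    ((continuousOn_iff_continuous_domRestrict.mp hl').add continuous_const)
    (by
      ext z
      simp only [Function.comp, Complex.exp_add, Complex.exp_sub, h z z.2, h x hx]
      rw [div_self (Complex.exp_ne_zero _), mul_one]) ⟨x, hx⟩ (by simp)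
  have := congrFun key ⟨y, hy⟩
  simp only at this
  rw [this]; ring

lemma hasLogOn_of_simplyConnected {U : Set ℂ} (hU : SimplyConnectedSpace U) (hUo : IsOpen U)
    {g : ℂ → ℂ} (hg : ContinuousOn g U) (h0 : ∀ z ∈ U, g z ≠ 0) : HasLogOn g U := by
  obtain ⟨l, hl, he⟩ := Complex.exists_continuousOn_eqOn_exp_comp (U := U) hU hUo hg
    (by rintro ⟨z, hz, h⟩; exact h0 z hz h)
  exact ⟨l, hl, he⟩

lemma not_hasLogOn_sphere (a : ℂ) {r : ℝ} (hr : 0 < r) :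
    ¬ HasLogOn (fun z => z - a) (sphere a r) := by
  rintro ⟨l, hl, he⟩
  have hc : Continuous fun t : ℝ => circleMap a r t := continuous_circleMap a r
  have h1 : Continuous fun t : ℝ => l (circleMap a r t) :=
    hl.comp_continuous hc fun t => circleMap_mem_sphere a hr.le t
  have := continuous_log_sub_const (S := (univ : Set ℝ)) isPreconnected_univ
    (l := fun t => l (circleMap a r t)) (l' := fun t => Complex.log r + t * Complex.I)
    h1.continuousOn (by fun_prop) (fun t _ => by
      rw [he _ (circleMap_mem_sphere a hr.le t), Complex.exp_add,
        Complex.exp_log (by exact_mod_cast hr.ne')]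
      simp [circleMap]) (mem_univ 0) (mem_univ (2 * Real.pi))
  have h2 : circleMap a r (2 * Real.pi) = circleMap a r 0 := by
    simpa using periodic_circleMap a r 0
  rw [h2] at this
  simp [Real.pi_ne_zero] at this

lemma hasLogOn_div_of_path {X : Type*} [TopologicalSpace X] {S : Set X} (H : I → X → ℂ)
    (hH : ContinuousOn (fun p : I × X => H p.1 p.2) (univ ×ˢ S)) (h0 : ∀ t, ∀ z ∈ S, H t z ≠ 0) :
    HasLogOn (fun z => H 1 z / H 0 z) S := by
  classical
  have hc : Continuous fun p : I × S => H p.1 p.2 :=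
    hH.comp_continuous (f := fun p : I × S => (p.1, (p.2 : X))) (by fun_prop)
      fun p => ⟨mem_univ _, p.2.2⟩
  have hc0 : Continuous fun p : I × S => H 0 p.2 :=
    hc.comp (by fun_prop : Continuous fun p : I × S => ((0 : I), p.2))
  let K : C(I × S, {z : ℂ // z ≠ 0}) :=
    ⟨fun p => ⟨H p.1 p.2 / H 0 p.2, div_ne_zero (h0 _ _ p.2.2) (h0 _ _ p.2.2)⟩,
      (hc.div hc0 fun p => h0 _ _ p.2.2).subtype_mk _⟩
  have hK0 : ∀ a : S, K (0, a) = ⟨Complex.exp ((0 : C(S, ℂ)) a), Complex.exp_ne_zero _⟩ := by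
    intro a
    apply Subtype.ext
    simp [K, div_self (h0 0 a a.2)]
  let L := Complex.isCoveringMap_exp.liftHomotopy K 0 hK0
  have hL : ∀ p, Complex.exp (L p) = K p := fun p =>
    congrArg Subtype.val (congrFun (Complex.isCoveringMap_exp.liftHomotopy_lifts K 0 hK0) p)
  refine ⟨fun z => if hz : z ∈ S then L (1, ⟨z, hz⟩) else 0, ?_, fun z hz => ?_⟩
  · rw [continuousOn_iff_continuous_domRestrict]
    have : S.domRestrict (fun z => if hz : z ∈ S then L (1, ⟨z, hz⟩) else 0)
        = fun z : S => L (1, z) := by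
      ext z; simp
    rw [this]
    fun_prop
  · simp only [dif_pos hz, hL]; rfl

lemma hasLogOn_sub_of_path {S : Set ℂ} {a b : ℂ} (c : I → ℂ) (hc : Continuous c)
    (h0 : c 0 = b) (h1 : c 1 = a) (hS : ∀ t, c t ∉ S) (h : HasLogOn (fun z => z - b) S) :
    HasLogOn (fun z => z - a) S := by
  have := hasLogOn_div_of_path (S := S) (fun t z => z - c t) (by fun_prop)
    (fun t z hz => sub_ne_zero.2 fun e => hS t (e ▸ hz))
  rw [h0, h1] at this
  refine (this.mul h).congr fun z hz => div_mul_cancel₀ _ ?_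
  exact sub_ne_zero.2 fun e => hS 0 (h0 ▸ e ▸ hz)

/-- A nonvanishing continuous function on an interval has a continuous logarithm. -/
lemma exists_log_lift {g : I → ℂ} (hg : Continuous g) (h0 : ∀ t, g t ≠ 0) :
    ∃ l : C(I, ℂ), ∀ t, Complex.exp (l t) = g t := by
  obtain ⟨Γ, hΓ, -⟩ := Complex.isCoveringMap_exp.exists_path_lifts
    ⟨fun t => (⟨g t, h0 t⟩ : {z : ℂ // z ≠ 0}), by fun_prop⟩ (Complex.log (g 0))
    (Subtype.ext (Complex.exp_log (h0 0)).symm)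
  exact ⟨Γ, fun t => congrArg Subtype.val (congrFun hΓ t)⟩

open Classical in
/-- The total increment of a continuous logarithm along a nonvanishing path. -/
noncomputable def logIncrement (g : I → ℂ) : ℂ :=
  if h : ∃ l : C(I, ℂ), ∀ t, Complex.exp (l t) = g t then h.choose 1 - h.choose 0 else 0

lemma logIncrement_eq {g l : I → ℂ} (hl : Continuous l) (h : ∀ t, Complex.exp (l t) = g t) :
    logIncrement g = l 1 - l 0 := by
  have hex : ∃ l : C(I, ℂ), ∀ t, Complex.exp (l t) = g t := ⟨⟨l, hl⟩, h⟩
  rw [logIncrement, dif_pos hex]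
  have := continuous_log_sub_const (S := (univ : Set I)) isPreconnected_univ
    hex.choose.continuous.continuousOn hl.continuousOn
    (fun t _ => (hex.choose_spec t).trans (h t).symm) (mem_univ 1) (mem_univ 0)
  linear_combination this

lemma logIncrement_mul {g g' : I → ℂ} (hg : Continuous g) (h0 : ∀ t, g t ≠ 0)
    (hg' : Continuous g') (h0' : ∀ t, g' t ≠ 0) :
    logIncrement (fun t => g t * g' t) = logIncrement g + logIncrement g' := by
  obtain ⟨l, hl⟩ := exists_log_lift hg h0
  obtain ⟨l', hl'⟩ := exists_log_lift hg' h0'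
  rw [logIncrement_eq l.continuous hl, logIncrement_eq l'.continuous hl',
    logIncrement_eq (l := fun t => l t + l' t) (by fun_prop)
      (fun t => by rw [Complex.exp_add, hl, hl'])]
  ring

lemma logIncrement_eq_zero_of_hasLogOn {X : Type*} [TopologicalSpace X] {S : Set X} {g : X → ℂ}
    (h : HasLogOn g S) {c : I → X} (hc : Continuous c) (hS : ∀ t, c t ∈ S) (h01 : c 0 = c 1) :
    logIncrement (fun t => g (c t)) = 0 := by
  obtain ⟨l, hl, he⟩ := h
  rw [logIncrement_eq (l := fun t => l (c t)) (hl.comp_continuous hc hS) (fun t => he _ (hS t)),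
    h01, sub_self]

lemma hasLogOn_of_norm_sub_one_lt {X : Type*} [TopologicalSpace X] {S : Set X} {g : X → ℂ}
    (hg : ContinuousOn g S) (h : ∀ x ∈ S, ‖g x - 1‖ < 1) : HasLogOn g S := by
  have hs : ∀ x ∈ S, g x ∈ Complex.slitPlane := fun x hx =>
    Complex.ball_one_subset_slitPlane (by simpa [dist_eq_norm] using h x hx)
  exact ⟨fun x => Complex.log (g x), hg.clog hs,
    fun x hx => Complex.exp_log (Complex.slitPlane_ne_zero (hs x hx))⟩

lemma logIncrement_eq_of_close {g g' : I → ℂ} (hg : Continuous g) (h0 : ∀ t, g t ≠ 0)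
    (hg' : Continuous g') (h01 : g 0 = g 1) (h01' : g' 0 = g' 1)
    (h : ∀ t, ‖g' t / g t - 1‖ < 1) : logIncrement g' = logIncrement g := by
  have hq : Continuous fun t => g' t / g t := hg'.div hg h0
  obtain ⟨l, hl, he⟩ := hasLogOn_of_norm_sub_one_lt (S := univ) hq.continuousOn fun t _ => h t
  obtain ⟨m, hm⟩ := exists_log_lift hg h0
  have hs : ∀ t, g' t / g t ∈ Complex.slitPlane := fun x =>
    Complex.ball_one_subset_slitPlane (by simpa [dist_eq_norm] using h x)
  rw [logIncrement_eq m.continuous hm, logIncrement_eq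
    (l := fun t => m t + Complex.log (g' t / g t)) (m.continuous.add (hq.clog hs))
    (fun t => by
      rw [Complex.exp_add, hm, Complex.exp_log (Complex.slitPlane_ne_zero (hs t)),
        mul_div_cancel₀ _ (h0 t)]), h01, h01']
  ring

lemma logIncrement_locally_constant {Z : Type*} [TopologicalSpace Z] {S : Set Z} {F : Z → I → ℂ}
    (hS : IsOpen S)
    (hF : ContinuousOn (fun p : Z × I => F p.1 p.2) (S ×ˢ univ)) (h0 : ∀ z ∈ S, ∀ t, F z t ≠ 0)
    (h01 : ∀ z ∈ S, F z 0 = F z 1) {z : Z} (hz : z ∈ S) :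
    ∀ᶠ w in 𝓝 z, logIncrement (F w) = logIncrement (F z) := by
  have hcz : ∀ w ∈ S, Continuous (F w) := fun w hw =>
    hF.comp_continuous (f := fun t => (w, t)) (by fun_prop) fun t => ⟨hw, mem_univ _⟩
  have : ∀ t ∈ (univ : Set I), ∀ᶠ q : Z × I in 𝓝 z ×ˢ 𝓝 t, ‖F q.1 q.2 / F z q.2 - 1‖ < 1 := by
    intro t _
    rw [← nhds_prod_eq]
    have hn : S ×ˢ (univ : Set I) ∈ 𝓝 (z, t) :=
      (hS.prod isOpen_univ).mem_nhds ⟨hz, mem_univ _⟩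
    have h1 : ContinuousAt (fun q : Z × I => F q.1 q.2) (z, t) := hF.continuousAt hn
    have h2 : ContinuousAt (fun q : Z × I => F z q.2) (z, t) :=
      ((hcz z hz).comp continuous_snd).continuousAt
    have h3 : ContinuousAt (fun q : Z × I => ‖F q.1 q.2 / F z q.2 - 1‖) (z, t) :=
      ((h1.div h2 (h0 z hz t)).sub continuousAt_const).norm
    refine h3.eventually_lt continuousAt_const ?_
    simp [div_self (h0 z hz t)]
  have key := isCompact_univ.eventually_forall_of_forall_eventually
    (x₀ := z) (P := fun w t => ‖F w t / F z t - 1‖ < 1) (by simpa only [nhds_prod_eq] using this)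
  filter_upwards [key, hS.mem_nhds hz] with w hw hwS
  exact logIncrement_eq_of_close (hcz z hz) (h0 z hz) (hcz w hwS) (h01 z hz) (h01 w hwS)
    fun t => hw t (mem_univ t)

lemma hasLogOn_of_loops {C : Set ℂ} (hC : IsOpen C) (hCc : IsConnected C) {f : ℂ → ℂ}
    (hf : ContinuousOn f C) (h0 : ∀ z ∈ C, f z ≠ 0)
    (h : ∀ c : I → ℂ, Continuous c → (∀ t, c t ∈ C) → c 0 = c 1 →
      logIncrement (fun t => f (c t)) = 0) : HasLogOn f C := by
  classical
  have hpc : PathConnectedSpace C :=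
    isPathConnected_iff_pathConnectedSpace.mp (hC.isConnected_iff_isPathConnected.mp hCc)
  have hlpc : LocallyPathConnectedSpace C := hC.locallyPathConnectedSpace
  obtain ⟨a, ha⟩ := hCc.nonempty
  let F : C(C, {z : ℂ // z ≠ 0}) := ⟨fun z => ⟨f z, h0 z z.2⟩,
    (continuousOn_iff_continuous_domRestrict.mp hf).subtype_mk _⟩
  have cov := Complex.isCoveringMap_exp
  have he : (⟨_, (Complex.log (f a)).exp_ne_zero⟩ : {z : ℂ // z ≠ 0}) = F ⟨a, ha⟩ :=
    Subtype.ext (Complex.exp_log (h0 a ha))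
  obtain ⟨L, ⟨-, hL⟩, -⟩ := cov.isLocalHomeomorph.existsUnique_continuousMap_lifts
    F ⟨a, ha⟩ (Complex.log (f a)) he
    (fun γ hγ => by
      simpa [and_comm] using cov.exists_path_lifts (F.comp γ) (Complex.log (f a))
        (by rw [he]; simp [hγ]))
    (fun γ γ' Γ Γ' hγ hγ' hΓ hΓ' hl hl' h1 => by
      have el : ∀ t, Complex.exp (Γ t) = f (γ t) := fun t => congrArg Subtype.val (congrFun hl t)
      have el' : ∀ t, Complex.exp (Γ' t) = f (γ' t) :=
        fun t => congrArg Subtype.val (congrFun hl' t)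
      let p : Path (⟨a, ha⟩ : C) (γ 1) := ⟨γ, hγ, rfl⟩
      let p' : Path (⟨a, ha⟩ : C) (γ 1) := ⟨γ', hγ', h1.symm⟩
      let P : Path (Γ 0) (Γ 1) := ⟨Γ, rfl, rfl⟩
      let P' : Path (Γ' 0 + (Γ 1 - Γ' 1)) (Γ 1) :=
        ⟨⟨fun t => Γ' t + (Γ 1 - Γ' 1), by fun_prop⟩, rfl, by simp⟩
      have hP' : ∀ t, Complex.exp (P' t) = f (p' t) := by
        intro t
        change Complex.exp (Γ' t + (Γ 1 - Γ' 1)) = f (γ' t)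
        rw [Complex.exp_add, Complex.exp_sub, el 1, el' 1, el' t, h1,
          div_self (h0 _ (γ' 1).2), mul_one]
      have := h (fun t => (p.trans p'.symm t : C)) (by fun_prop) (fun t => Subtype.coe_prop _)
        (by simp)
      rw [logIncrement_eq (l := P.trans P'.symm) (by fun_prop) (fun t => by
        simp only [Path.trans_apply]
        split_ifs
        · exact el _
        · exact hP' _)] at this
      simp only [Path.target, Path.source, hΓ, hΓ'] at this
      linear_combination this)
  have hL' : ∀ z : C, Complex.exp (L z) = f z := fun z => congrArg Subtype.val (congrFun hL z)
  refine ⟨fun z => if hz : z ∈ C then L ⟨z, hz⟩ else 0, ?_, fun z hz => ?_⟩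
  · rw [continuousOn_iff_continuous_domRestrict]
    have : C.domRestrict (fun z => if hz : z ∈ C then L ⟨z, hz⟩ else 0) = L := by
      ext z; simp
    rw [this]
    fun_prop
  · simp only [hL', dif_pos hz]

/-- The increment of a logarithm of `z - a` along the path `c`. -/
noncomputable def windingIncrement (c : I → ℂ) (a : ℂ) : ℂ := logIncrement fun t => c t - a

lemma windingIncrement_eventually_eq {c : I → ℂ} (hc : Continuous c) (h01 : c 0 = c 1) {a : ℂ}
    (ha : a ∉ range c) : ∀ᶠ b in 𝓝 a, windingIncrement c b = windingIncrement c a := by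
  have hcl : IsOpen (range c)ᶜ := (isCompact_range hc).isClosed.isOpen_compl
  refine logIncrement_locally_constant (F := fun b t => c t - b) hcl (by fun_prop)
    (fun z hz t => sub_ne_zero.2 fun e => hz ⟨t, e⟩) (fun z _ => by rw [h01]) ha

lemma hasLogOn_const {X : Type*} [TopologicalSpace X] {S : Set X} {a : ℂ} (ha : a ≠ 0) :
    HasLogOn (fun _ : X => a) S :=
  ⟨fun _ => Complex.log a, continuousOn_const, fun _ _ => Complex.exp_log ha⟩

lemma hasLogOn_sub_ball (a : ℂ) : HasLogOn (fun z => z - a) (ball 0 ‖a‖) := by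
  rcases eq_or_ne a 0 with rfl | ha
  · exact ⟨0, continuousOn_const, by simp⟩
  have h := hasLogOn_of_norm_sub_one_lt (S := ball (0 : ℂ) ‖a‖) (g := fun z => (z - a) / (-a))
    (by fun_prop) (fun z hz => by
      have : (z - a) / (-a) - 1 = - (z / a) := by field_simp; ring
      rw [this, norm_neg, norm_div, div_lt_one (norm_pos_iff.2 ha)]
      simpa using hz)
  exact (h.mul (hasLogOn_const (neg_ne_zero.2 ha))).congr fun z _ =>
    div_mul_cancel₀ _ (neg_ne_zero.2 ha)

lemma windingIncrement_eq_zero_of_norm_lt {c : I → ℂ} (hc : Continuous c) (h01 : c 0 = c 1)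
    {a : ℂ} (ha : ∀ t, ‖c t‖ < ‖a‖) : windingIncrement c a = 0 :=
  logIncrement_eq_zero_of_hasLogOn (hasLogOn_sub_ball a) hc (fun t => by simpa using ha t) h01

/-- The points on a loop together with the points it winds around. -/
def loopHull (c : I → ℂ) : Set ℂ := {a | a ∈ range c ∨ windingIncrement c a ≠ 0}

lemma isCompact_loopHull {c : I → ℂ} (hc : Continuous c) (h01 : c 0 = c 1) :
    IsCompact (loopHull c) := by
  refine Metric.isCompact_of_isClosed_isBounded ?_ ?_
  · rw [← isOpen_compl_iff, isOpen_iff_mem_nhds]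
    intro a ha
    simp only [loopHull, mem_compl_iff, mem_ofPred_eq, not_or, not_not] at ha
    filter_upwards [windingIncrement_eventually_eq hc h01 ha.1,
      (isCompact_range hc).isClosed.isOpen_compl.mem_nhds ha.1] with b hb hb'
    simp only [loopHull, mem_compl_iff, mem_ofPred_eq, not_or, not_not]
    exact ⟨hb', hb.trans ha.2⟩
  · obtain ⟨R, hR⟩ := (isCompact_range hc).isBounded.exists_norm_le
    refine (isBounded_closedBall (x := (0 : ℂ)) (r := R)).subset fun a ha => ?_
    rw [mem_closedBall_zero_iff]
    rcases ha with ha | ha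
    · exact hR a ha
    · by_contra! hlt
      exact ha (windingIncrement_eq_zero_of_norm_lt hc h01 fun t => (hR _ ⟨t, rfl⟩).trans_lt hlt)

open Classical in
lemma continuousOn_slope_prod {C : Set ℂ} (hC : IsOpen C) {f : ℂ → ℂ}
    (hf : DifferentiableOn ℂ f C) :
    ContinuousOn (fun p : ℂ × ℂ => if p.1 = p.2 then deriv f p.1
      else (f p.1 - f p.2) / (p.1 - p.2)) (C ×ˢ C) := by
  rintro ⟨z, w⟩ ⟨hz, hw⟩
  apply ContinuousAt.continuousWithinAt
  simp only at hz hw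
  by_cases h : z = w
  · subst h
    have hd : HasStrictDerivAt f (deriv f z) z :=
      (hf.analyticAt (hC.mem_nhds hz)).hasStrictDerivAt
    have hdc : ContinuousAt (deriv f) z :=
      ((hf.analyticAt (hC.mem_nhds hz)).deriv).continuousAt
    have h1 : Tendsto (fun p : ℂ × ℂ => ‖deriv f p.1 - deriv f z‖) (𝓝 (z, z)) (𝓝 0) := by
      have : ContinuousAt (fun p : ℂ × ℂ => ‖deriv f p.1 - deriv f z‖) (z, z) :=
        ((hdc.comp (x := (z, z)) (f := Prod.fst) continuousAt_fst).sub continuousAt_const).norm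
      simpa [ContinuousAt] using this
    rw [Metric.continuousAt_iff']
    intro ε hε
    have h2 := hd.hasStrictFDerivAt.isLittleO.def (half_pos hε)
    filter_upwards [h2, h1.eventually_lt_const hε] with p hp hp'
    simp only [if_true]
    split_ifs with he
    · simpa [dist_eq_norm] using hp'
    · have hne : p.1 - p.2 ≠ 0 := sub_ne_zero.2 he
      rw [dist_eq_norm]
      have : (f p.1 - f p.2) / (p.1 - p.2) - deriv f z
          = (f p.1 - f p.2 - (p.1 - p.2) • deriv f z) / (p.1 - p.2) := by
        rw [smul_eq_mul]; field_simp
      rw [this, norm_div, div_lt_iff₀ (norm_pos_iff.2 hne)]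
      refine lt_of_le_of_lt hp ?_
      have := norm_pos_iff.2 hne
      nlinarith
  · have hev : ∀ᶠ p : ℂ × ℂ in 𝓝 (z, w), p.1 ≠ p.2 :=
      (isOpen_ne_fun continuous_fst continuous_snd).mem_nhds h
    have hfz : ContinuousAt f z := (hf.differentiableAt (hC.mem_nhds hz)).continuousAt
    have hfw : ContinuousAt f w := (hf.differentiableAt (hC.mem_nhds hw)).continuousAt
    have : ContinuousAt (fun p : ℂ × ℂ => (f p.1 - f p.2) / (p.1 - p.2)) (z, w) :=
      ((hfz.comp (x := (z, w)) (f := Prod.fst) continuousAt_fst).sub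
        (hfw.comp (x := (z, w)) (f := Prod.snd) continuousAt_snd)).div
        (continuousAt_fst.sub continuousAt_snd) (sub_ne_zero.2 h)
    refine this.congr ?_
    filter_upwards [hev] with p hp
    rw [if_neg hp]

lemma isOpen_image_of_deriv_ne_zero {C : Set ℂ} (hC : IsOpen C) {f : ℂ → ℂ}
    (hf : DifferentiableOn ℂ f C) (hd : ∀ z ∈ C, deriv f z ≠ 0) : IsOpen (f '' C) := by
  rw [isOpen_iff_mem_nhds]
  rintro _ ⟨z, hz, rfl⟩
  rw [← ((hf.analyticAt (hC.mem_nhds hz)).hasStrictDerivAt).map_nhds_eq (hd z hz)]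
  exact image_mem_map (hC.mem_nhds hz)

/-- If every `z - a` with `a ∉ C` has a continuous logarithm on `C`, then so does every
nonvanishing univalent function on `C`. -/
theorem hasLogOn_of_injOn {C : Set ℂ} (hC : IsOpen C) (hCc : IsConnected C)
    (hlog : ∀ a ∉ C, HasLogOn (fun z => z - a) C) {f : ℂ → ℂ} (hf : DifferentiableOn ℂ f C)
    (hinj : InjOn f C) (hd : ∀ z ∈ C, deriv f z ≠ 0) (h0 : ∀ z ∈ C, f z ≠ 0) :
    HasLogOn f C := by
  classical
  refine hasLogOn_of_loops hC hCc hf.continuousOn h0 fun c hc hcC h01 => ?_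
  have hfc : Continuous fun t => f (c t) := hf.continuousOn.comp_continuous hc hcC
  have hfo : IsOpen (f '' C) := isOpen_image_of_deriv_ne_zero hC hf hd
  have hsub : loopHull c ⊆ C := by
    rintro a (⟨t, rfl⟩ | ha)
    · exact hcC t
    · by_contra hn
      exact ha (logIncrement_eq_zero_of_hasLogOn (hlog a hn) hc hcC h01)
  have hK := isCompact_loopHull hc h01
  have hfK : IsCompact (f '' loopHull c) := hK.image_of_continuousOn (hf.continuousOn.mono hsub)
  let q : ℂ → I → ℂ := fun ζ t => if c t = ζ then deriv f (c t) else (f (c t) - f ζ) / (c t - ζ)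
  have hq0 : ∀ ζ ∈ C, ∀ t, q ζ t ≠ 0 := by
    intro ζ hζ t
    simp only [q]
    split_ifs with h
    · exact hd _ (hcC t)
    · exact div_ne_zero (sub_ne_zero.2 fun e => h (hinj (hcC t) hζ e)) (sub_ne_zero.2 h)
  have hqc : ContinuousOn (fun p : ℂ × I => q p.1 p.2) (C ×ˢ univ) :=
    (continuousOn_slope_prod hC hf).comp (f := fun p : ℂ × I => (c p.2, p.1)) (by fun_prop)
      fun p hp => ⟨hcC _, hp.1⟩
  have hq01 : ∀ ζ, q ζ 0 = q ζ 1 := fun ζ => by simp only [q, h01]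
  have hqct : ∀ ζ ∈ C, Continuous (q ζ) := fun ζ hζ =>
    hqc.comp_continuous (f := fun t => (ζ, t)) (by fun_prop) fun t => ⟨hζ, mem_univ _⟩
  have hconst : ∀ ζ ∈ C, ∀ ζ' ∈ C, logIncrement (q ζ) = logIncrement (q ζ') := by
    have : PreconnectedSpace C := Subtype.preconnectedSpace hCc.isPreconnected
    have hlc : IsLocallyConstant fun ζ : C => logIncrement (q ζ) := by
      rw [IsLocallyConstant.iff_eventually_eq]
      intro ζ
      exact continuous_subtype_val.continuousAt.eventually
        (logIncrement_locally_constant hC hqc hq0 (fun ζ _ => hq01 ζ) ζ.2)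
    intro ζ hζ ζ' hζ'
    exact hlc.apply_eq_of_preconnectedSpace ⟨ζ, hζ⟩ ⟨ζ', hζ'⟩
  have hadd : ∀ ζ ∈ C, ζ ∉ range c → windingIncrement (fun t => f (c t)) (f ζ)
      = logIncrement (q ζ) + windingIncrement c ζ := by
    intro ζ hζ hr
    have hne : ∀ t, c t - ζ ≠ 0 := fun t => sub_ne_zero.2 fun e => hr ⟨t, e⟩
    rw [windingIncrement, windingIncrement, ← logIncrement_mul (hqct ζ hζ) (hq0 ζ hζ)
      (by fun_prop) hne]
    congr 1
    ext t
    simp only [q]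
    rw [if_neg (sub_ne_zero.1 (hne t)), div_mul_cancel₀ _ (hne t)]
  have hne : (f '' loopHull c).Nonempty := ⟨f (c 0), c 0, Or.inl ⟨0, rfl⟩, rfl⟩
  obtain ⟨m, hm, hmax⟩ := hfK.exists_isMaxOn hne continuous_norm.continuousOn
  have hzero : ∀ ζ ∈ C, logIncrement (q ζ) = 0 := by
    have hmC : f '' C ∈ 𝓝 m := hfo.mem_nhds (image_mono hsub hm)
    obtain ⟨_, ⟨ζ, hζ, rfl⟩, hlt⟩ : ∃ y ∈ f '' C, ‖m‖ < ‖y‖ := by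
      by_contra! hcon
      obtain ⟨ε, hε, hb⟩ := Metric.mem_nhds_iff.mp hmC
      rcases eq_or_ne m 0 with rfl | hm0
      · have := hcon ((ε / 2 : ℝ) : ℂ) (hb (by
          simp [abs_of_pos hε]; linarith))
        simp at this
        linarith [le_abs_self ε]
      · have hmp := norm_pos_iff.2 hm0
        have h2 : ‖m + ((ε / 2 / ‖m‖ : ℝ) : ℂ) * m‖ = ‖m‖ + ε / 2 := by
          have : m + ((ε / 2 / ‖m‖ : ℝ) : ℂ) * m = ((1 + ε / 2 / ‖m‖ : ℝ) : ℂ) * m := by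
            push_cast; ring
          rw [this, norm_mul, Complex.norm_real, Real.norm_of_nonneg (by positivity)]
          field_simp
        have := hcon (m + ((ε / 2 / ‖m‖ : ℝ) : ℂ) * m) (hb (by
          rw [mem_ball, dist_eq_norm, add_sub_cancel_left, norm_mul, Complex.norm_real,
            Real.norm_of_nonneg (by positivity), div_mul_cancel₀ _ hmp.ne']
          linarith))
        linarith
    have hnot : ζ ∉ loopHull c := fun h => by
      have := hmax ⟨ζ, h, rfl⟩
      simp only [mem_ofPred_eq] at this
      linarith
    simp only [loopHull, mem_ofPred_eq, not_or, not_not] at hnot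
    have h1 := hadd ζ hζ hnot.1
    rw [hnot.2, add_zero, windingIncrement_eq_zero_of_norm_lt hfc (by simp only [h01])
      (fun t => lt_of_le_of_lt (hmax ⟨c t, Or.inl ⟨t, rfl⟩, rfl⟩) hlt)] at h1
    intro ζ' hζ'
    rw [hconst ζ' hζ' ζ hζ, ← h1]
  by_contra hw
  have hw0 : windingIncrement (fun t => f (c t)) 0 ≠ 0 := by simpa [windingIncrement] using hw
  let T : Set ℂ := loopHull (fun t => f (c t)) \ f '' C
  have hTc : IsCompact T := (isCompact_loopHull hfc (by simp only [h01])).diff hfo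
  have h0T : (0 : ℂ) ∈ T := ⟨Or.inr hw0, by rintro ⟨z, hz, h⟩; exact h0 z hz h⟩
  have hTo : IsOpen T := by
    rw [isOpen_iff_mem_nhds]
    rintro a ⟨ha, haC⟩
    have har : a ∉ range fun t => f (c t) := by
      rintro ⟨t, rfl⟩; exact haC ⟨c t, hcC t, rfl⟩
    have haw := ha.resolve_left har
    filter_upwards [windingIncrement_eventually_eq hfc (by simp only [h01]) har,
      hfK.isClosed.isOpen_compl.mem_nhds fun h => haC (image_mono hsub h)] with b hb hbK
    refine ⟨Or.inr (hb ▸ haw), ?_⟩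
    rintro ⟨ζ, hζ, rfl⟩
    have hnot : ζ ∉ loopHull c := fun h => hbK ⟨ζ, h, rfl⟩
    simp only [loopHull, mem_ofPred_eq, not_or, not_not] at hnot
    rw [hadd ζ hζ hnot.1, hzero ζ hζ, hnot.2, add_zero] at hb
    exact haw hb.symm
  have := IsClopen.eq_univ ⟨hTc.isClosed, hTo⟩ ⟨0, h0T⟩
  exact noncompact_univ ℂ (this ▸ hTc)

/-- Univalent functions on `C`: injective holomorphic functions, the nonvanishing of the
derivative being part of the definition. -/
structure IsUnivalentOn (f : ℂ → ℂ) (C : Set ℂ) : Prop where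
  differentiableOn : DifferentiableOn ℂ f C
  injOn : InjOn f C
  deriv_ne_zero : ∀ z ∈ C, deriv f z ≠ 0

lemma IsUnivalentOn.hasDerivAt {f : ℂ → ℂ} {C : Set ℂ} (hf : IsUnivalentOn f C) (hC : IsOpen C)
    {z : ℂ} (hz : z ∈ C) : HasDerivAt f (deriv f z) z :=
  (hf.differentiableOn.differentiableAt (hC.mem_nhds hz)).hasDerivAt

/-- The Blaschke factor of the unit disk that vanishes at `a`. -/
noncomputable def blaschke (a w : ℂ) : ℂ := (w - a) / (1 - star a * w)

lemma one_sub_star_mul_ne_zero {a w : ℂ} (ha : ‖a‖ < 1) (hw : ‖w‖ < 1) : 1 - star a * w ≠ 0 := by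
  intro h
  have : ‖star a * w‖ = 1 := by rw [← sub_eq_zero.1 h, norm_one]
  rw [norm_mul, norm_star] at this
  nlinarith [norm_nonneg a, norm_nonneg w]

lemma norm_blaschke_lt_one {a w : ℂ} (ha : ‖a‖ < 1) (hw : ‖w‖ < 1) : ‖blaschke a w‖ < 1 := by
  have h := one_sub_star_mul_ne_zero ha hw
  rw [blaschke, norm_div, div_lt_one (norm_pos_iff.2 h)]
  refine lt_of_pow_lt_pow_left₀ 2 (norm_nonneg _) ?_
  have ha2 : a.re ^ 2 + a.im ^ 2 < 1 := by
    have := Complex.sq_norm a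
    rw [Complex.normSq_apply] at this
    nlinarith [norm_nonneg a]
  have hw2 : w.re ^ 2 + w.im ^ 2 < 1 := by
    have := Complex.sq_norm w
    rw [Complex.normSq_apply] at this
    nlinarith [norm_nonneg w]
  rw [Complex.sq_norm, Complex.sq_norm, Complex.normSq_apply, Complex.normSq_apply]
  simp
  nlinarith [mul_pos (sub_pos.2 ha2) (sub_pos.2 hw2)]

lemma hasDerivAt_blaschke {a w : ℂ} (ha : ‖a‖ < 1) (hw : ‖w‖ < 1) :
    HasDerivAt (blaschke a) ((1 - star a * a) / (1 - star a * w) ^ 2) w := by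
  have h := one_sub_star_mul_ne_zero ha hw
  have h1 : HasDerivAt (fun w : ℂ => w - a) 1 w := (hasDerivAt_id w).sub_const a
  have h2 : HasDerivAt (fun w : ℂ => 1 - star a * w) (-(star a * 1)) w :=
    ((hasDerivAt_id w).const_mul (star a)).const_sub 1
  refine (h1.div h2 h).congr_deriv ?_
  congr 1
  ring

lemma blaschke_injective {a w w' : ℂ} (ha : ‖a‖ < 1) (hw : ‖w‖ < 1) (hw' : ‖w'‖ < 1)
    (h : blaschke a w = blaschke a w') : w = w' := by
  have h1 := one_sub_star_mul_ne_zero ha hw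
  have h2 := one_sub_star_mul_ne_zero ha hw'
  have h3 := one_sub_star_mul_ne_zero ha ha
  rw [blaschke, blaschke, div_eq_div_iff h1 h2] at h
  refine mul_right_cancel₀ h3 ?_
  linear_combination h

lemma IsUnivalentOn.blaschke_comp {f : ℂ → ℂ} {C : Set ℂ} (hC : IsOpen C)
    (hf : IsUnivalentOn f C) (hm : MapsTo f C (ball 0 1)) {a : ℂ} (ha : ‖a‖ < 1) :
    IsUnivalentOn (fun z => blaschke a (f z)) C ∧
      MapsTo (fun z => blaschke a (f z)) C (ball 0 1) ∧
      ∀ z ∈ C, deriv (fun z => blaschke a (f z)) z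
        = (1 - star a * a) / (1 - star a * f z) ^ 2 * deriv f z := by
  have hn : ∀ z ∈ C, ‖f z‖ < 1 := fun z hz => by simpa using hm hz
  have hd : ∀ z ∈ C, HasDerivAt (fun z => blaschke a (f z))
      ((1 - star a * a) / (1 - star a * f z) ^ 2 * deriv f z) z := fun z hz =>
    (hasDerivAt_blaschke ha (hn z hz)).comp z (hf.hasDerivAt hC hz)
  refine ⟨⟨fun z hz => (hd z hz).differentiableAt.differentiableWithinAt, fun z hz w hw h =>
    hf.injOn hz hw (blaschke_injective ha (hn z hz) (hn w hw) h), fun z hz => ?_⟩,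
    fun z hz => by simpa using norm_blaschke_lt_one ha (hn z hz), fun z hz => (hd z hz).deriv⟩
  rw [(hd z hz).deriv]
  exact mul_ne_zero (div_ne_zero (one_sub_star_mul_ne_zero ha ha)
    (pow_ne_zero _ (one_sub_star_mul_ne_zero ha (hn z hz)))) (hf.deriv_ne_zero z hz)

lemma IsUnivalentOn.exists_sqrt {g : ℂ → ℂ} {C : Set ℂ} (hC : IsOpen C)
    (hg : IsUnivalentOn g C) (hlog : HasLogOn g C) :
    ∃ s, IsUnivalentOn s C ∧ (∀ z ∈ C, s z ^ 2 = g z) ∧ ∀ z ∈ C, 2 * s z * deriv s z = deriv g z := by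
  obtain ⟨l, hl, hlg⟩ := hlog
  have hs2 : ∀ z ∈ C, Complex.exp (l z / 2) ^ 2 = g z := fun z hz => by
    rw [← hlg z hz, sq, ← Complex.exp_add, add_halves]
  have hsc : ContinuousOn (fun z => Complex.exp (l z / 2)) C := by fun_prop
  have hd : ∀ z ∈ C, HasDerivAt (fun z => Complex.exp (l z / 2))
      ((2 * Complex.exp (l z / 2))⁻¹ * deriv g z) z := by
    intro z hz
    have hg' : HasStrictDerivAt g (deriv g z) z :=
      (hg.differentiableOn.analyticAt (hC.mem_nhds hz)).hasStrictDerivAt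
    have hsz := hsc.continuousAt (hC.mem_nhds hz)
    have hpow : HasStrictDerivAt (fun w : ℂ => w ^ 2) (2 * Complex.exp (l z / 2))
        (Complex.exp (l z / 2)) := by
      simpa using hasStrictDerivAt_pow 2 (Complex.exp (l z / 2))
    have hne : 2 * Complex.exp (l z / 2) ≠ 0 := mul_ne_zero two_ne_zero (Complex.exp_ne_zero _)
    let φ := hpow.localInverse _ _ _ hne
    have hφ : HasStrictDerivAt φ (2 * Complex.exp (l z / 2))⁻¹ (g z) := by
      have := hpow.to_localInverse hne
      rwa [hs2 z hz] at this
    refine (hφ.hasDerivAt.comp z hg'.hasDerivAt).congr_of_eventuallyEq ?_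
    have hev := hsz.eventually (hpow.hasStrictFDerivAt_equiv hne).eventually_left_inverse
    filter_upwards [hev, hC.mem_nhds hz] with w hw hwC
    rw [Function.comp_apply, ← hs2 w hwC]
    exact hw.symm
  have hd2 : ∀ z ∈ C, 2 * Complex.exp (l z / 2) * deriv (fun z => Complex.exp (l z / 2)) z
      = deriv g z := fun z hz => by
    rw [(hd z hz).deriv, mul_inv_cancel_left₀ (mul_ne_zero two_ne_zero (Complex.exp_ne_zero _))]
  refine ⟨_, ⟨fun z hz => (hd z hz).differentiableAt.differentiableWithinAt,
    fun z hz w hw h => hg.injOn hz hw ?_, fun z hz h => ?_⟩, hs2, hd2⟩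
  · rw [← hs2 z hz, ← hs2 w hw, h]
  · have := hd2 z hz
    rw [h, mul_zero] at this
    exact hg.deriv_ne_zero z hz this.symm

lemma exists_isUnivalentOn_mapsTo_ball {C : Set ℂ} (hC : IsOpen C) {z₀ a : ℂ} (hz₀ : z₀ ∈ C)
    (ha : a ∉ C) (hlog : HasLogOn (fun z => z - a) C) :
    ∃ f, IsUnivalentOn f C ∧ MapsTo f C (ball 0 1) := by
  have hda : ∀ z, HasDerivAt (fun z => z - a) 1 z := fun z => (hasDerivAt_id z).sub_const a
  have hu : IsUnivalentOn (fun z => z - a) C :=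
    ⟨by fun_prop, fun z _ w _ h => sub_left_injective h, fun z _ => by simp [(hda z).deriv]⟩
  obtain ⟨s, hs, hs2, -⟩ := hu.exists_sqrt hC hlog
  have hs0 : ∀ z ∈ C, s z ≠ 0 := fun z hz h => by
    have := hs2 z hz
    rw [h] at this
    exact ha ((sub_eq_zero.1 (by simpa using this.symm) : z = a) ▸ hz)
  have hneg : ∀ z ∈ C, ∀ w ∈ C, s z ≠ -s w := fun z hz w hw h => by
    have hzw : z - a = w - a := by rw [← hs2 z hz, ← hs2 w hw, h, neg_sq]
    obtain rfl := sub_left_injective hzw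
    exact hs0 z hz (self_eq_neg.1 h)
  obtain ⟨ε, hε, hb⟩ := Metric.isOpen_iff.1
    (isOpen_image_of_deriv_ne_zero hC hs.differentiableOn hs.deriv_ne_zero) (s z₀) ⟨z₀, hz₀, rfl⟩
  have hfar : ∀ z ∈ C, ε ≤ ‖s z + s z₀‖ := fun z hz => by
    by_contra! hlt
    obtain ⟨w, hw, h⟩ := hb (show -s z ∈ ball (s z₀) ε by
      rwa [mem_ball, dist_eq_norm, ← norm_neg, neg_sub, sub_neg_eq_add, add_comm])
    exact hneg w hw z hz h
  have hne : ∀ z ∈ C, s z + s z₀ ≠ 0 := fun z hz => norm_pos_iff.1 (hε.trans_le (hfar z hz))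
  have hd : ∀ z ∈ C, HasDerivAt (fun z => ((ε / 2 : ℝ) : ℂ) * (s z + s z₀)⁻¹)
      (((ε / 2 : ℝ) : ℂ) * (-deriv s z / (s z + s z₀) ^ 2)) z := fun z hz =>
    (((hs.hasDerivAt hC hz).add_const _).fun_inv (hne z hz)).const_mul _
  have hε0 : ((ε / 2 : ℝ) : ℂ) ≠ 0 := Complex.ofReal_ne_zero.2 (by positivity)
  refine ⟨fun z => ((ε / 2 : ℝ) : ℂ) * (s z + s z₀)⁻¹,
    ⟨fun z hz => (hd z hz).differentiableAt.differentiableWithinAt, fun z hz w hw h => ?_,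
      fun z hz => ?_⟩, fun z hz => ?_⟩
  · exact hs.injOn hz hw (add_left_injective _ (inv_injective (mul_left_cancel₀ hε0 h)))
  · rw [(hd z hz).deriv]
    exact mul_ne_zero hε0 (div_ne_zero (neg_ne_zero.2 (hs.deriv_ne_zero z hz))
      (pow_ne_zero _ (hne z hz)))
  · have := hfar z hz
    rw [mem_ball_zero_iff, norm_mul, norm_inv, Complex.norm_real,
      Real.norm_of_nonneg (by positivity), ← div_eq_mul_inv, div_lt_one (by linarith)]
    linarith

section NormalFamilies

variable {ι : Type*}

/-- A local form of Hurwitz's theorem. -/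
lemma ne_zero_of_tendstoUniformlyOn_closedBall {φ : Filter ι} [φ.NeBot] {F : ι → ℂ → ℂ}
    {f : ℂ → ℂ} {a : ℂ} {r : ℝ} (hr : 0 < r)
    (hF : ∀ᶠ n in φ, ContinuousOn (F n) (closedBall a r) ∧ DifferentiableOn ℂ (F n) (ball a r))
    (h0 : ∀ᶠ n in φ, ∀ z ∈ closedBall a r, F n z ≠ 0)
    (hf : TendstoUniformlyOn F f φ (closedBall a r)) (hs : ∀ z ∈ sphere a r, f z ≠ 0) :
    f a ≠ 0 := by
  have hfc : ContinuousOn f (closedBall a r) := hf.continuousOn (hF.mono fun _ h => h.1).frequently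
  obtain ⟨m, hm, hmin⟩ := (isCompact_sphere a r).exists_isMinOn
    (NormedSpace.sphere_nonempty.2 hr.le) (hfc.mono sphere_subset_closedBall).norm
  have hδ : 0 < ‖f m‖ := norm_pos_iff.2 (hs m hm)
  obtain ⟨n, ⟨hc, hd⟩, h0n, hn⟩ := (hF.and (h0.and (Metric.tendstoUniformlyOn_iff.1 hf
    (‖f m‖ / 3) (by positivity)))).exists
  have hbound : ‖(F n a)⁻¹‖ ≤ (2 * ‖f m‖ / 3)⁻¹ := by
    refine Complex.norm_le_of_forall_mem_frontier_norm_le (f := fun z => (F n z)⁻¹)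
      (isBounded_ball (x := a) (r := r)) ⟨hd.inv fun z hz => h0n z (ball_subset_closedBall hz), ?_⟩
      (fun z hz => ?_) (subset_closure (mem_ball_self hr))
    · rw [closure_ball a hr.ne']
      exact hc.inv₀ h0n
    · rw [frontier_ball a hr.ne'] at hz
      rw [norm_inv]
      refine inv_anti₀ (by positivity) ?_
      have h1 := hn z (sphere_subset_closedBall hz)
      have h2 : ‖f m‖ ≤ ‖f z‖ := hmin hz
      rw [dist_eq_norm] at h1
      have := norm_sub_norm_le (f z) (F n z)
      linarith
  have ha := mem_closedBall_self (x := a) hr.le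
  rw [norm_inv, inv_le_inv₀ (norm_pos_iff.2 (h0n a ha)) (by positivity)] at hbound
  intro h
  have := hn a ha
  rw [h, dist_zero_left] at this
  linarith

/-- Hurwitz's theorem: a locally uniform limit of nonvanishing holomorphic functions either has no
zeros or vanishes identically. -/
theorem eqOn_zero_or_forall_ne_zero_of_tendstoLocallyUniformlyOn {φ : Filter ι} [φ.NeBot]
    {F : ι → ℂ → ℂ} {f : ℂ → ℂ} {U : Set ℂ} (hU : IsOpen U) (hUc : IsPreconnected U)
    (hF : ∀ n, DifferentiableOn ℂ (F n) U) (h0 : ∀ n, ∀ z ∈ U, F n z ≠ 0)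
    (hf : TendstoLocallyUniformlyOn F f φ U) : EqOn f 0 U ∨ ∀ z ∈ U, f z ≠ 0 := by
  have hfd : DifferentiableOn ℂ f U := hf.differentiableOn (Eventually.of_forall hF) hU
  by_contra! h
  obtain ⟨hne, a, ha, hfa⟩ := h
  have han : AnalyticOnNhd ℂ f U := hfd.analyticOnNhd hU
  rcases (han a ha).eventually_eq_zero_or_eventually_ne_zero with h | h
  · exact hne (han.eqOn_zero_of_preconnected_of_eventuallyEq_zero hUc ha h)
  · rw [eventually_nhdsWithin_iff] at h
    obtain ⟨r, hr, hb⟩ := Metric.nhds_basis_closedBall.mem_iff.1 (h.and (hU.mem_nhds ha))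
    have hbU : closedBall a r ⊆ U := fun z hz => (hb hz).2
    exact ne_zero_of_tendstoUniformlyOn_closedBall hr
      (Eventually.of_forall fun n => ⟨(hF n).continuousOn.mono hbU,
        (hF n).mono (ball_subset_closedBall.trans hbU)⟩)
      (Eventually.of_forall fun n z hz => h0 n z (hbU hz))
      ((tendstoLocallyUniformlyOn_iff_forall_isCompact hU).1 hf _ hbU (isCompact_closedBall a r))
      (fun z hz => (hb (sphere_subset_closedBall hz)).1 (ne_of_mem_sphere hz hr.ne')) hfa

/-- Montel's theorem for ultrafilters. -/
theorem exists_tendstoLocallyUniformlyOn_of_mapsTo_ball (φ : Ultrafilter ι) {F : ι → ℂ → ℂ}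
    {U : Set ℂ} (hU : IsOpen U) (hF : ∀ n, DifferentiableOn ℂ (F n) U)
    (hm : ∀ n, MapsTo (F n) U (ball 0 1)) :
    ∃ f, MapsTo f U (closedBall 0 1) ∧ TendstoLocallyUniformlyOn F f φ U := by
  have hlim : ∀ z, ∃ y, z ∈ U → y ∈ closedBall (0 : ℂ) 1 ∧ Tendsto (fun n => F n z) φ (𝓝 y) := by
    intro z
    by_cases hz : z ∈ U
    · obtain ⟨y, hy, hy'⟩ := (isCompact_closedBall (0 : ℂ) 1).ultrafilter_le_nhds
        (φ.map fun n => F n z) (by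
          rw [le_principal_iff, Ultrafilter.mem_coe, Ultrafilter.mem_map]
          exact univ_mem' fun n => ball_subset_closedBall (hm n hz))
      exact ⟨y, fun _ => ⟨hy, hy'⟩⟩
    · exact ⟨0, fun h => absurd h hz⟩
  choose f hf using hlim
  refine ⟨f, fun z hz => (hf z hz).1, ?_⟩
  rw [Metric.tendstoLocallyUniformlyOn_iff]
  intro ε hε x hx
  obtain ⟨r, hr, hb⟩ := Metric.isOpen_iff.1 hU x hx
  have hlip : ∀ n, ∀ y ∈ ball x r, dist (F n y) (F n x) ≤ 2 / r * dist y x := fun n y hy =>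
    Complex.dist_le_div_mul_dist_of_mapsTo_ball ((hF n).mono hb) (fun w hw => by
      have h1 : ‖F n w‖ < 1 := by simpa using hm n (hb hw)
      have h2 : ‖F n x‖ < 1 := by simpa using hm n hx
      rw [mem_closedBall, dist_eq_norm]
      linarith [norm_sub_le (F n w) (F n x)]) hy
  have hlip' : ∀ y ∈ ball x r, dist (f y) (f x) ≤ 2 / r * dist y x := fun y hy =>
    le_of_tendsto ((hf y (hb hy)).2.dist (hf x hx).2) (Eventually.of_forall fun n => hlip n y hy)
  refine ⟨ball x (min r (ε * r / 8)), mem_nhdsWithin_of_mem_nhds (ball_mem_nhds _ (by positivity)),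
    ?_⟩
  filter_upwards [(hf x hx).2.eventually (ball_mem_nhds (f x) (by positivity : 0 < ε / 4))]
    with n hn y hy
  have hy1 : y ∈ ball x r := ball_subset_ball (min_le_left _ _) hy
  have hy2 : dist y x < ε * r / 8 := lt_of_lt_of_le hy (min_le_right _ _)
  have hy3 : 2 / r * dist y x ≤ ε / 4 := by
    have : 2 / r * dist y x ≤ 2 / r * (ε * r / 8) := by gcongr
    refine this.trans_eq ?_
    field_simp
    norm_num
  have h1 := hlip n y hy1
  have h2 := hlip' y hy1
  have h3 := dist_triangle4 (f y) (f x) (F n x) (F n y)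
  rw [dist_comm (f x), dist_comm (F n x) (F n y)] at h3
  linarith

end NormalFamilies

/-- A locally uniform limit of univalent functions is univalent, provided that its derivative does
not vanish somewhere. -/
lemma isUnivalentOn_of_tendstoLocallyUniformlyOn {ι : Type*} {φ : Filter ι} [φ.NeBot]
    {F : ι → ℂ → ℂ} {f : ℂ → ℂ} {U : Set ℂ} (hU : IsOpen U) (hUc : IsPreconnected U)
    (hF : ∀ n, IsUnivalentOn (F n) U) (hf : TendstoLocallyUniformlyOn F f φ U) {z₀ : ℂ}
    (hz₀ : z₀ ∈ U) (hd : deriv f z₀ ≠ 0) : IsUnivalentOn f U := by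
  have hFd : ∀ᶠ n in φ, DifferentiableOn ℂ (F n) U :=
    Eventually.of_forall fun n => (hF n).differentiableOn
  have hfd : DifferentiableOn ℂ f U := hf.differentiableOn hFd hU
  have hdne : ∀ z ∈ U, deriv f z ≠ 0 := by
    refine (eqOn_zero_or_forall_ne_zero_of_tendstoLocallyUniformlyOn hU hUc
      (fun n => (hF n).differentiableOn.deriv hU) (fun n => (hF n).deriv_ne_zero)
      (hf.deriv hFd hU)).resolve_left fun h => hd (h hz₀)
  refine ⟨hfd, fun z hz w hw h => ?_, hdne⟩
  by_contra hzw
  obtain ⟨r, hr, hb⟩ := Metric.isOpen_iff.1 (hU.sdiff isClosed_singleton) z ⟨hz, hzw⟩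
  have hlim : TendstoLocallyUniformlyOn (fun n ζ => F n ζ - F n w) (fun ζ => f ζ - f w) φ
      (ball z r) := by
    have h1 : TendstoLocallyUniformlyOn F f φ (ball z r) := hf.mono fun ζ hζ => (hb hζ).1
    rw [Metric.tendstoLocallyUniformlyOn_iff] at h1 ⊢
    intro ε hε x hx
    obtain ⟨t, ht, h2⟩ := h1 (ε / 2) (half_pos hε) x hx
    refine ⟨t, ht, ?_⟩
    filter_upwards [h2, (hf.tendsto_at hw).eventually (ball_mem_nhds _ (half_pos hε))]
      with n hn hn' y hy
    have := dist_sub_sub_le (f y) (f w) (F n y) (F n w)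
    rw [dist_comm] at hn'
    linarith [hn y hy]
  rcases eqOn_zero_or_forall_ne_zero_of_tendstoLocallyUniformlyOn isOpen_ball
    (convex_ball z r).isPreconnected
    (fun n => ((hF n).differentiableOn.mono fun ζ hζ => (hb hζ).1).sub_const _)
    (fun n ζ hζ => sub_ne_zero.2 fun e => (hb hζ).2 ((hF n).injOn (hb hζ).1 hw e)) hlim with h1 | h1
  · have : f =ᶠ[𝓝 z] fun _ => f w := by
      filter_upwards [ball_mem_nhds z hr] with ζ hζ
      exact sub_eq_zero.1 (h1 hζ)
    exact hdne z hz (by rw [this.deriv_eq, deriv_const])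
  · exact h1 z (mem_ball_self hr) (sub_eq_zero.2 h)

/-- The Koebe transform: a univalent function to the unit disk that fixes the base value `0` and
omits a value can be replaced by one with a larger derivative at the base point. -/
lemma IsUnivalentOn.exists_norm_deriv_lt {C : Set ℂ} (hC : IsOpen C) (hCc : IsConnected C)
    (hlog : ∀ a ∉ C, HasLogOn (fun z => z - a) C) {f : ℂ → ℂ} (hf : IsUnivalentOn f C)
    (hm : MapsTo f C (ball 0 1)) {z₀ : ℂ} (hz₀ : z₀ ∈ C) (hf0 : f z₀ = 0) {b : ℂ} (hb : ‖b‖ < 1)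
    (hbf : b ∉ f '' C) :
    ∃ g, IsUnivalentOn g C ∧ MapsTo g C (ball 0 1) ∧ g z₀ = 0 ∧ ‖deriv f z₀‖ < ‖deriv g z₀‖ := by
  obtain ⟨hg, hgm, hgd⟩ := hf.blaschke_comp hC hm hb
  have hn : ∀ z ∈ C, ‖f z‖ < 1 := fun z hz => by simpa using hm hz
  have hg0 : ∀ z ∈ C, blaschke b (f z) ≠ 0 := fun z hz =>
    div_ne_zero (sub_ne_zero.2 fun e => hbf ⟨z, hz, e⟩) (one_sub_star_mul_ne_zero hb (hn z hz))
  obtain ⟨s, hs, hs2, hsd⟩ := hg.exists_sqrt hC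
    (hasLogOn_of_injOn hC hCc hlog hg.differentiableOn hg.injOn hg.deriv_ne_zero hg0)
  have hsm : MapsTo s C (ball 0 1) := fun z hz => by
    have h1 : ‖s z‖ ^ 2 < 1 := by
      rw [← norm_pow, hs2 z hz]
      simpa using hgm hz
    rw [mem_ball_zero_iff]
    nlinarith [norm_nonneg (s z)]
  have hsn : ‖s z₀‖ < 1 := by simpa using hsm hz₀
  obtain ⟨hk, hkm, hkd⟩ := hs.blaschke_comp hC hsm hsn
  refine ⟨_, hk, hkm, by simp [blaschke], ?_⟩
  have hb2 : ‖s z₀‖ ^ 2 = ‖b‖ := by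
    rw [← norm_pow, hs2 z₀ hz₀, hf0]
    simp [blaschke]
  have hs0 : 0 < ‖s z₀‖ := norm_pos_iff.2 fun h => hg0 z₀ hz₀ (by rw [← hs2 z₀ hz₀, h]; simp)
  have e : ∀ w : ℂ, ‖w‖ < 1 → ‖1 - star w * w‖ = 1 - ‖w‖ ^ 2 := fun w hw => by
    have : 1 - star w * w = ((1 - ‖w‖ ^ 2 : ℝ) : ℂ) := by
      push_cast
      rw [← Complex.conj_mul']
      rfl
    rw [this, Complex.norm_real, Real.norm_of_nonneg]
    nlinarith [norm_nonneg w]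
  have h1 := congrArg norm (hsd z₀ hz₀)
  rw [hgd z₀ hz₀, hf0, norm_mul, norm_mul, norm_mul, mul_zero, sub_zero, one_pow, div_one, e b hb,
    ← hb2, Complex.norm_ofNat] at h1
  have hs1 : 0 < 1 - ‖s z₀‖ ^ 2 := by nlinarith
  rw [hkd z₀ hz₀, norm_mul, norm_div, norm_pow, e _ hsn]
  have hf' : 0 < ‖deriv f z₀‖ := norm_pos_iff.2 (hf.deriv_ne_zero z₀ hz₀)
  set x := ‖s z₀‖
  set D := ‖deriv f z₀‖
  have h2 : ‖deriv s z₀‖ = (1 - x ^ 2) * (1 + x ^ 2) * D / (2 * x) := by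
    rw [eq_div_iff (by positivity)]
    linear_combination h1
  rw [h2, show (1 - x ^ 2) / (1 - x ^ 2) ^ 2 * ((1 - x ^ 2) * (1 + x ^ 2) * D / (2 * x))
    = (1 + x ^ 2) * D / (2 * x) by field_simp, lt_div_iff₀ (by positivity)]
  nlinarith [mul_pos hf' (pow_pos (sub_pos.2 hsn) 2)]

/-- A form of the Riemann mapping theorem. -/
theorem exists_isUnivalentOn_image_eq_ball {C : Set ℂ} (hC : IsOpen C) (hCc : IsConnected C)
    (hne : C ≠ univ) (hlog : ∀ a ∉ C, HasLogOn (fun z => z - a) C) :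
    ∃ f, IsUnivalentOn f C ∧ f '' C = ball 0 1 := by
  obtain ⟨z₀, hz₀⟩ := hCc.nonempty
  obtain ⟨a, ha⟩ := (ne_univ_iff_exists_notMem C).1 hne
  let 𝓕 : Set (ℂ → ℂ) := {f | IsUnivalentOn f C ∧ MapsTo f C (ball 0 1) ∧ f z₀ = 0}
  have h𝓕 : 𝓕.Nonempty := by
    obtain ⟨f, hf, hm⟩ := exists_isUnivalentOn_mapsTo_ball hC hz₀ ha (hlog a ha)
    obtain ⟨h1, h2, -⟩ := hf.blaschke_comp hC hm (show ‖f z₀‖ < 1 by simpa using hm hz₀)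
    exact ⟨_, h1, h2, by simp [blaschke]⟩
  let S : Set ℝ := (fun f => ‖deriv f z₀‖) '' 𝓕
  obtain ⟨r, hr, hrC⟩ := Metric.isOpen_iff.1 hC z₀ hz₀
  have hS : BddAbove S := by
    refine ⟨1 / r, ?_⟩
    rintro _ ⟨f, ⟨hf, hm, hf0⟩, rfl⟩
    refine Complex.norm_deriv_le_div_of_mapsTo_ball (hf.differentiableOn.mono hrC)
      (fun z hz => ?_) hr
    rw [hf0]
    exact ball_subset_closedBall (hm (hrC hz))
  obtain ⟨u, -, hu, huS⟩ := exists_seq_tendsto_sSup (h𝓕.image _) hS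
  choose F hF hFu using huS
  obtain ⟨f, hfm, hf⟩ := exists_tendstoLocallyUniformlyOn_of_mapsTo_ball (hyperfilter ℕ) hC
    (fun n => (hF n).1.differentiableOn) (fun n => (hF n).2.1)
  have hle : (hyperfilter ℕ : Filter ℕ) ≤ atTop := by
    rw [← Nat.cofinite_eq_atTop]
    exact hyperfilter_le_cofinite
  have hfd : ‖deriv f z₀‖ = sSup S := by
    refine tendsto_nhds_unique ?_ (hu.mono_left hle)
    have h1 := ((hf.deriv (Eventually.of_forall fun n => (hF n).1.differentiableOn)
      hC).tendsto_at hz₀).norm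
    exact h1.congr fun n => hFu n
  have hpos : 0 < sSup S := by
    obtain ⟨g, hg⟩ := h𝓕
    exact (norm_pos_iff.2 (hg.1.deriv_ne_zero z₀ hz₀)).trans_le (le_csSup hS ⟨g, hg, rfl⟩)
  have hfu : IsUnivalentOn f C := isUnivalentOn_of_tendstoLocallyUniformlyOn hC hCc.isPreconnected
    (fun n => (hF n).1) hf hz₀ (norm_pos_iff.1 (hfd ▸ hpos))
  have hfo := isOpen_image_of_deriv_ne_zero hC hfu.differentiableOn hfu.deriv_ne_zero
  have hfb : f '' C ⊆ ball 0 1 := by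
    rw [← interior_closedBall (0 : ℂ) one_ne_zero]
    exact interior_maximal hfm.image_subset hfo
  have hf0 : f z₀ = 0 :=
    tendsto_nhds_unique (hf.tendsto_at hz₀) (tendsto_const_nhds.congr fun n => ((hF n).2.2).symm)
  refine ⟨f, hfu, hfb.antisymm fun b hb => ?_⟩
  by_contra hbf
  obtain ⟨g, hg, hgm, hg0, hlt⟩ := hfu.exists_norm_deriv_lt hC hCc hlog (image_subset_iff.1 hfb)
    hz₀ hf0 (by simpa using hb) hbf
  exact (hlt.trans_le (le_csSup hS ⟨g, ⟨hg, hgm, hg0⟩, rfl⟩)).ne hfd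

/-- A proper subdomain `C` of the plane on which all functions `z - a` with `a ∉ C` have continuous
logarithms is simply connected. -/
theorem simplyConnectedSpace_of_hasLogOn {C : Set ℂ} (hC : IsOpen C) (hCc : IsConnected C)
    (hne : C ≠ univ) (hlog : ∀ a ∉ C, HasLogOn (fun z => z - a) C) : SimplyConnectedSpace C := by
  obtain ⟨f, hf, hfC⟩ := exists_isUnivalentOn_image_eq_ball hC hCc hne hlog
  have hopen : IsOpenMap (C.domRestrict f) := by
    intro V hV
    have h1 : IsOpen (((↑) : C → ℂ) '' V) := hC.isOpenMap_subtype_val V hV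
    have h2 : ((↑) : C → ℂ) '' V ⊆ C := by rintro _ ⟨z, -, rfl⟩; exact z.2
    have := isOpen_image_of_deriv_ne_zero h1 (hf.differentiableOn.mono h2)
      fun z hz => hf.deriv_ne_zero z (h2 hz)
    rwa [image_image] at this
  have hemb : IsOpenEmbedding (C.domRestrict f) :=
    .of_continuous_injective_isOpenMap
      (continuousOn_iff_continuous_domRestrict.1 hf.differentiableOn.continuousOn)
      (fun z w h => Subtype.ext (hf.injOn z.2 w.2 h)) hopen
  have hrange : range (C.domRestrict f) = ball 0 1 := by rw [range_domRestrict, hfC]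
  have : ContractibleSpace (range (C.domRestrict f)) := by
    rw [hrange]
    exact (convex_ball (0 : ℂ) 1).contractibleSpace (nonempty_ball.2 one_pos)
  have := SimplyConnectedSpace.ofContractible (range (C.domRestrict f))
  exact hemb.isEmbedding.toHomeomorph.toHomotopyEquiv.simplyConnectedSpace

lemma hasLogOn_of_convex {S : Set ℂ} (hS : Convex ℝ S) (hne : S.Nonempty) (hSo : IsOpen S)
    {g : ℂ → ℂ} (hg : ContinuousOn g S) (h0 : ∀ z ∈ S, g z ≠ 0) : HasLogOn g S := by
  have := hS.contractibleSpace hne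
  exact hasLogOn_of_simplyConnected (SimplyConnectedSpace.ofContractible S) hSo hg h0

lemma isPreconnected_compl_closedBall_zero {R : ℝ} (hR : 0 < R) :
    IsPreconnected (closedBall (0 : ℂ) R)ᶜ := by
  have : (closedBall (0 : ℂ) R)ᶜ = Complex.exp '' {z | Real.log R < z.re} := by
    ext z
    rw [mem_compl_iff, mem_closedBall_zero_iff, not_le]
    constructor
    · intro h
      have hz : z ≠ 0 := norm_pos_iff.1 (hR.trans h)
      refine ⟨Complex.log z, ?_, Complex.exp_log hz⟩
      rw [mem_ofPred_eq, Complex.log_re]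
      exact Real.log_lt_log hR h
    · rintro ⟨w, hw, rfl⟩
      rw [Complex.norm_exp]
      exact (Real.log_lt_iff_lt_exp hR).1 hw
  rw [this]
  exact (convex_halfSpace_re_gt _).isPreconnected.image _ Complex.continuous_exp.continuousOn

/-- If `z - a` has a continuous logarithm on the compact set `J`, then the component of `a` in the
complement of `J` is unbounded. -/
lemma not_connectedComponentIn_subset_closedBall {J : Set ℂ} (hJ : IsClosed J) {a : ℂ}
    (ha : a ∉ J) (hlog : HasLogOn (fun z => z - a) J) (R : ℝ) :
    ¬ connectedComponentIn Jᶜ a ⊆ closedBall 0 R := by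
  classical
  intro hsub
  set C := connectedComponentIn Jᶜ a
  have hCo : IsOpen C := hJ.isOpen_compl.connectedComponentIn
  have haC : a ∈ C := mem_connectedComponentIn ha
  have hCb : frontier C ⊆ J := by
    rw [hCo.frontier_eq]
    rintro z ⟨hz, hzC⟩
    by_contra hzJ
    refine hzC ?_
    have : connectedComponentIn Jᶜ z ∈ 𝓝 z :=
      hJ.isOpen_compl.connectedComponentIn.mem_nhds (mem_connectedComponentIn hzJ)
    obtain ⟨w, hw, hwC⟩ := mem_closure_iff_nhds.1 hz _ this
    rw [show C = connectedComponentIn Jᶜ z from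
      (connectedComponentIn_eq hwC).trans (connectedComponentIn_eq hw).symm]
    exact mem_connectedComponentIn hzJ
  obtain ⟨l, hl, hle⟩ := hlog
  obtain ⟨H, hH⟩ := ContinuousMap.exists_extension' (hJ.isClosedEmbedding_subtypeVal)
    (⟨J.domRestrict l, continuousOn_iff_continuous_domRestrict.1 hl⟩ : C(J, ℂ))
  have hHJ : ∀ z ∈ J, Complex.exp (H z) = z - a := fun z hz =>
    (congrArg Complex.exp (congrFun hH ⟨z, hz⟩)).trans (hle z hz)
  have hF : Continuous (C.piecewise (fun z => Complex.exp (H z)) (fun z => z - a)) :=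
    Continuous.piecewise (fun z hz => hHJ z (hCb hz)) (by fun_prop) (by fun_prop)
  have h0 : ∀ z, C.piecewise (fun z => Complex.exp (H z)) (fun z => z - a) z ≠ 0 := fun z => by
    by_cases hz : z ∈ C
    · rw [piecewise_eq_of_mem _ _ _ hz]
      exact Complex.exp_ne_zero _
    · rw [piecewise_eq_of_notMem _ _ _ hz]
      exact sub_ne_zero.2 fun e => hz (e ▸ haC)
  have hpos : 0 < |R| + ‖a‖ + 1 := by positivity
  refine not_hasLogOn_sphere a hpos (((hasLogOn_of_convex convex_univ univ_nonempty isOpen_univ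
    hF.continuousOn fun z _ => h0 z).mono (subset_univ _)).congr fun z hz =>
    piecewise_eq_of_notMem _ _ _ fun hzC => ?_)
  have h1 := hsub hzC
  rw [mem_closedBall_zero_iff] at h1
  rw [mem_sphere, dist_eq_norm] at hz
  linarith [norm_sub_le z a, le_abs_self R]

lemma isPreconnected_compl_of_hasLogOn {J : Set ℂ} (hJ : IsCompact J)
    (hlog : ∀ a ∉ J, HasLogOn (fun z => z - a) J) : IsPreconnected Jᶜ := by
  obtain ⟨R, hR0, hR⟩ : ∃ R > 0, J ⊆ closedBall 0 R := by
    obtain ⟨R, hR⟩ := hJ.isBounded.exists_norm_le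
    exact ⟨|R| + 1, by positivity, fun z hz => by
      rw [mem_closedBall_zero_iff]
      linarith [hR z hz, le_abs_self R]⟩
  have hB : (closedBall (0 : ℂ) R)ᶜ ⊆ Jᶜ := compl_subset_compl.2 hR
  have hx : ((R + 1 : ℝ) : ℂ) ∈ (closedBall (0 : ℂ) R)ᶜ := by
    rw [mem_compl_iff, mem_closedBall_zero_iff, Complex.norm_real, Real.norm_of_nonneg (by linarith)]
    linarith
  refine isPreconnected_of_forall ((R + 1 : ℝ) : ℂ) fun a ha => ?_
  obtain ⟨z, hz, hzR⟩ := not_subset.1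
    (not_connectedComponentIn_subset_closedBall hJ.isClosed ha (hlog a ha) R)
  exact ⟨_, union_subset hB (connectedComponentIn_subset Jᶜ a), Or.inl hx,
    Or.inr (mem_connectedComponentIn ha), (isPreconnected_compl_closedBall_zero hR0).union z hzR hz
      isPreconnected_connectedComponentIn⟩

lemma hasLogOn_sub_range {f : I → ℂ} (hf : Continuous f) (hinj : Function.Injective f) {a : ℂ}
    (ha : a ∉ range f) : HasLogOn (fun z => z - a) (range f) := by
  obtain ⟨l, hle⟩ := exists_log_lift (g := fun t => f t - a) (by fun_prop)
    fun t => sub_ne_zero.2 fun e => ha ⟨t, e⟩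
  obtain ⟨H, hH⟩ := ContinuousMap.exists_extension' (hf.isClosedEmbedding hinj) l
  refine ⟨H, H.continuous.continuousOn, ?_⟩
  rintro _ ⟨t, rfl⟩
  exact (congrArg Complex.exp (congrFun hH t)).trans (hle t)

/-- An arc does not separate the plane. -/
theorem isPreconnected_compl_range {f : I → ℂ} (hf : Continuous f) (hinj : Function.Injective f) :
    IsPreconnected (range f)ᶜ :=
  isPreconnected_compl_of_hasLogOn (isCompact_range hf) fun _ => hasLogOn_sub_range hf hinj

lemma HasLogOn.union_of_isPreconnected_inter {X : Type*} [TopologicalSpace X] {U V : Set X}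
    {g : X → ℂ} (hU : IsOpen U) (hV : IsOpen V) (hUV : IsPreconnected (U ∩ V))
    (h : HasLogOn g U) (h' : HasLogOn g V) : HasLogOn g (U ∪ V) := by
  classical
  obtain ⟨l, hl, he⟩ := h
  obtain ⟨l', hl', he'⟩ := h'
  obtain ⟨c, hc, hc1⟩ : ∃ c, (∀ x ∈ U ∩ V, l x - l' x = c) ∧ Complex.exp c = 1 := by
    rcases (U ∩ V).eq_empty_or_nonempty with hemp | ⟨x, hx⟩
    · exact ⟨0, by simp [hemp], Complex.exp_zero⟩
    · refine ⟨l x - l' x, fun y hy => continuous_log_sub_const hUV (hl.mono inter_subset_left)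
        (hl'.mono inter_subset_right) (fun z hz => (he z hz.1).trans (he' z hz.2).symm) hy hx, ?_⟩
      rw [Complex.exp_sub, he x hx.1, ← he' x hx.2, div_self (Complex.exp_ne_zero _)]
  have hp : ∀ x ∈ V, U.piecewise l (fun x => l' x + c) x = l' x + c := fun x hx => by
    by_cases hxU : x ∈ U
    · rw [piecewise_eq_of_mem _ _ _ hxU, ← hc x ⟨hxU, hx⟩]
      ring
    · exact piecewise_eq_of_notMem _ _ _ hxU
  refine ⟨U.piecewise l (fun x => l' x + c), ContinuousOn.union_of_isOpen
    (hl.congr fun x hx => piecewise_eq_of_mem _ _ _ hx) ((hl'.add continuousOn_const).congr hp)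
    hU hV, ?_⟩
  rintro x (hx | hx)
  · rw [piecewise_eq_of_mem _ _ _ hx, he x hx]
  · rw [hp x hx, Complex.exp_add, hc1, mul_one, he' x hx]

lemma not_hasLogOn_div_compl_pair {p q : ℂ} (hpq : p ≠ q) :
    ¬ HasLogOn (fun z => (z - p) / (z - q)) {p, q}ᶜ := by
  intro h
  have hr : 0 < ‖p - q‖ := norm_pos_iff.2 (sub_ne_zero.2 hpq)
  have hq : HasLogOn (fun z => z - q) (ball p ‖p - q‖) :=
    hasLogOn_of_convex (convex_ball _ _) (nonempty_ball.2 hr) isOpen_ball (by fun_prop)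
      fun z hz e => by
        rw [sub_eq_zero.1 e, mem_ball, dist_comm, dist_eq_norm] at hz
        exact lt_irrefl _ hz
  have hs1 : sphere p (‖p - q‖ / 2) ⊆ ball p ‖p - q‖ := sphere_subset_ball (half_lt_self hr)
  have hsq : ∀ z ∈ sphere p (‖p - q‖ / 2), z ≠ q := by
    rintro z hz rfl
    have := hs1 hz
    rw [mem_ball, dist_comm, dist_eq_norm] at this
    exact lt_irrefl _ this
  refine not_hasLogOn_sphere p (half_pos hr) (((h.mono fun z hz => ?_).mul (hq.mono hs1)).congr
    fun z hz => div_mul_cancel₀ _ (sub_ne_zero.2 (hsq z hz)))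
  rintro (rfl | rfl)
  · exact ne_of_mem_sphere hz (half_pos hr).ne' rfl
  · exact hsq z hz rfl

/-- A crosscut separates a simply connected domain. -/
lemma not_isPreconnected_diff_range {G : Set ℂ} (hG : IsOpen G) (hGs : SimplyConnectedSpace G)
    {f : I → ℂ} (hf : Continuous f) (hinj : Function.Injective f) (h0 : f 0 ∉ G) (h1 : f 1 ∉ G)
    (hfG : range f \ {f 0, f 1} ⊆ G) : ¬ IsPreconnected (G \ range f) := by
  intro hpre
  have hpq : f 0 ≠ f 1 := fun e => zero_ne_one (hinj e)
  have hl1 : HasLogOn (fun z => (z - f 0) / (z - f 1)) (range f)ᶜ := by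
    have := hasLogOn_div_of_path (S := (range f)ᶜ) (fun t z => z - f (unitInterval.symm t))
      (by fun_prop) (fun t z hz => sub_ne_zero.2 fun e => hz ⟨_, e.symm⟩)
    simpa using this
  have hl2 : HasLogOn (fun z => (z - f 0) / (z - f 1)) G := by
    have e0 : ∀ z ∈ G, z - f 0 ≠ 0 := fun z hz e => h0 (sub_eq_zero.1 e ▸ hz)
    have e1 : ∀ z ∈ G, z - f 1 ≠ 0 := fun z hz e => h1 (sub_eq_zero.1 e ▸ hz)
    exact hasLogOn_of_simplyConnected hGs hG (ContinuousOn.div (by fun_prop) (by fun_prop) e1)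
      fun z hz => div_ne_zero (e0 z hz) (e1 z hz)
  refine not_hasLogOn_div_compl_pair hpq ((hl2.union_of_isPreconnected_inter hG
    (isCompact_range hf).isClosed.isOpen_compl (by rwa [← sdiff_eq]) hl1).mono fun z hz => ?_)
  by_cases hzJ : z ∈ range f
  · exact Or.inl (hfG ⟨hzJ, hz⟩)
  · exact Or.inr hzJ

/-- If `C` and `C'` are disjoint, then the logarithms of `z - a` on `C`, for `a ∉ C ∪ C'`, give those
for `a ∈ C'` too. -/
lemma hasLogOn_sub_of_disjoint {C C' : Set ℂ} (hC : IsOpen C) (hC' : IsOpen C')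
    (hd : Disjoint C C') (hne : C' ≠ univ)
    (h : ∀ a ∉ C ∪ C', HasLogOn (fun z => z - a) C) {a : ℂ} (ha : a ∉ C) :
    HasLogOn (fun z => z - a) C := by
  by_cases haC' : a ∈ C'
  swap
  · exact h a (by simp [ha, haC'])
  obtain ⟨e, he⟩ := (ne_univ_iff_exists_notMem C').1 hne
  let c : ℝ → ℂ := fun t => AffineMap.lineMap a e t
  have hc : Continuous c := AffineMap.lineMap_continuous
  have hTc : IsCompact (Icc (0 : ℝ) 1 ∩ c ⁻¹' C'ᶜ) :=
    isCompact_Icc.inter_right (hC'.isClosed_compl.preimage hc)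
  obtain ⟨t₀, ⟨ht₀, ht₀C⟩, hmin⟩ := hTc.exists_isLeast ⟨1, by simp [c, he]⟩
  have hlt : ∀ t, 0 ≤ t → t < t₀ → c t ∈ C' := fun t h1 h2 => by
    by_contra hn
    exact absurd (hmin ⟨⟨h1, h2.le.trans ht₀.2⟩, hn⟩) (not_le.2 h2)
  have hpos : 0 < t₀ := by
    refine ht₀.1.lt_of_ne ?_
    rintro rfl
    exact ht₀C (by simpa [c] using haC')
  have hb : c t₀ ∉ C := fun hcC => by
    have h1 : ∀ᶠ t in 𝓝[<] t₀, c t ∈ C :=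
      (hc.continuousAt.eventually (hC.mem_nhds hcC)).filter_mono nhdsWithin_le_nhds
    have h2 : ∀ᶠ t in 𝓝[<] t₀, t ∈ Ioo 0 t₀ := Ioo_mem_nhdsLT hpos
    obtain ⟨t, h3, h4⟩ := (h1.and h2).exists
    exact disjoint_left.1 hd h3 (hlt t h4.1.le h4.2)
  refine hasLogOn_sub_of_path (b := c t₀) (fun t : I => c (t₀ * (1 - t))) (by fun_prop) (by simp)
    (by simp [c]) (fun t htC => ?_) (h _ (by rintro (h1 | h1); exacts [hb h1, ht₀C h1]))
  rcases eq_or_ne (t : ℝ) 0 with h1 | h1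
  · exact hb (by simpa [h1] using htC)
  · have h2 : 0 < (t : ℝ) := t.2.1.lt_of_ne' h1
    exact disjoint_left.1 hd htC
      (hlt _ (mul_nonneg hpos.le (sub_nonneg.2 t.2.2)) (by nlinarith))

/-- A nonvanishing continuous function on the punctured plane is, up to a power of the coordinate,
an exponential. -/
lemma exists_hasLogOn_mul_zpow_compl_zero {h : ℂ → ℂ} (hc : ContinuousOn h {0}ᶜ)
    (h0 : ∀ z ≠ 0, h z ≠ 0) : ∃ k : ℤ, HasLogOn (fun z => h z * z ^ k) {0}ᶜ := by
  have he : ∀ z, Complex.exp z ∈ ({0}ᶜ : Set ℂ) := fun z => Complex.exp_ne_zero z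
  obtain ⟨l, hl, hle⟩ := hasLogOn_of_convex (g := fun z => h (Complex.exp z)) convex_univ
    univ_nonempty isOpen_univ (hc.comp_continuous Complex.continuous_exp he).continuousOn
    fun z _ => h0 _ (he z)
  rw [continuousOn_univ] at hl
  have hshift : ∀ z, Complex.exp (l (z + 2 * Real.pi * Complex.I)) = Complex.exp (l z) := fun z => by
    rw [hle _ trivial, hle _ trivial]
    simp only [Complex.exp_periodic z]
  obtain ⟨k, hk⟩ : ∃ k : ℤ, l (0 + 2 * Real.pi * Complex.I) = l 0 + k * (2 * Real.pi * Complex.I) :=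
    Complex.exp_eq_exp_iff_exists_int.1 (hshift 0)
  have hlk : ∀ z, l (z + 2 * Real.pi * Complex.I) = l z + k * (2 * Real.pi * Complex.I) := fun z => by
    have := continuous_log_sub_const (S := (univ : Set ℂ)) isPreconnected_univ
      (l := fun z => l (z + 2 * Real.pi * Complex.I)) (l' := l) (by fun_prop) hl.continuousOn
      (fun z _ => hshift z) (mem_univ z) (mem_univ 0)
    linear_combination this + hk
  set m : ℂ → ℂ := fun z => l z - k * z with hm
  have hmc : Continuous m := by fun_prop
  have hper : Function.Periodic m (2 * Real.pi * Complex.I) := fun z => by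
    simp only [hm, hlk]
    ring
  have hmlog : ∀ z w, Complex.exp z = Complex.exp w → m z = m w := fun z w hzw => by
    obtain ⟨n, hn⟩ := Complex.exp_eq_exp_iff_exists_int.1 hzw
    rw [hn]
    exact hper.int_mul n w
  refine ⟨-k, fun z => m (Complex.log z), fun z hz => ContinuousAt.continuousWithinAt ?_,
    fun z hz => ?_⟩
  · by_cases hs : z ∈ Complex.slitPlane
    · exact hmc.continuousAt.comp (continuousAt_clog hs)
    · have hs' : -z ∈ Complex.slitPlane :=
        (Complex.mem_slitPlane_or_neg_mem_slitPlane hz).resolve_left hs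
      have h1 : ContinuousAt (fun w => m (Complex.log (-w) + Real.pi * Complex.I)) z :=
        hmc.continuousAt.comp ((ContinuousAt.comp (f := fun w : ℂ => -w)
          (continuousAt_clog hs') continuous_neg.continuousAt).add continuousAt_const)
      refine h1.congr ?_
      filter_upwards [isOpen_compl_singleton.mem_nhds hz] with w hw
      refine hmlog _ _ ?_
      rw [Complex.exp_add, Complex.exp_log (neg_ne_zero.2 hw), Complex.exp_log hw,
        Complex.exp_pi_mul_I]
      ring
  · simp only [hm]
    rw [Complex.exp_sub, Complex.exp_int_mul, hle _ trivial, zpow_neg, div_eq_mul_inv]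
    simp only [Complex.exp_log hz]

lemma exists_hasLogOn_mul_zpow_compl_pair {p q : ℂ} (hpq : p ≠ q) {h : ℂ → ℂ} {R : ℝ}
    (hc : ContinuousOn h {p, q}ᶜ) (h0 : ∀ z, h z ≠ 0) (hR : ∀ z, R < ‖z‖ → h z = 1) :
    ∃ k : ℤ, HasLogOn (fun z => h z * ((z - p) / (z - q)) ^ k) {p, q}ᶜ := by
  classical
  set g : ℂ → ℂ := fun w => if w = 1 then 1 else h ((q * w - p) / (w - 1)) with hg
  have hqp : q - p ≠ 0 := sub_ne_zero.2 hpq.symm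
  have hgc : ContinuousOn g {0}ᶜ := by
    intro w hw
    refine ContinuousAt.continuousWithinAt ?_
    rcases eq_or_ne w 1 with rfl | hw1
    · have : ∀ᶠ w : ℂ in 𝓝 1, R * ‖w - 1‖ < ‖q * w - p‖ := by
        refine ContinuousAt.eventually_lt (by fun_prop) (by fun_prop) ?_
        simpa using hqp
      refine (continuousAt_const (y := (1 : ℂ))).congr ?_
      filter_upwards [this] with w hw
      by_cases hw1 : w = 1
      · simp [hg, hw1]
      · simp only [hg, if_neg hw1]
        refine (hR _ ?_).symm
        rw [norm_div, lt_div_iff₀ (norm_pos_iff.2 (sub_ne_zero.2 hw1))]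
        exact hw
    · have hw1' : w - 1 ≠ 0 := sub_ne_zero.2 hw1
      have hmem : (q * w - p) / (w - 1) ∈ ({p, q}ᶜ : Set ℂ) := by
        rintro (e | e)
        · rw [div_eq_iff hw1'] at e
          exact hw ((mul_eq_zero.1 (show (q - p) * w = 0 by linear_combination e)).resolve_left hqp)
        · rw [mem_singleton_iff, div_eq_iff hw1'] at e
          exact hqp (by linear_combination e)
      have hopen : IsOpen ({p, q}ᶜ : Set ℂ) := (toFinite _).isClosed.isOpen_compl
      have h1 : ContinuousAt (fun w => h ((q * w - p) / (w - 1))) w :=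
        ContinuousAt.comp (f := fun w => (q * w - p) / (w - 1))
          (hc.continuousAt (hopen.mem_nhds hmem))
          (ContinuousAt.div (by fun_prop) (by fun_prop) hw1')
      refine h1.congr ?_
      filter_upwards [isOpen_compl_singleton.mem_nhds hw1] with w hw
      exact (if_neg hw).symm
  obtain ⟨k, l, hl, hle⟩ := exists_hasLogOn_mul_zpow_compl_zero hgc fun z _ => by
    simp only [hg]
    split_ifs
    exacts [one_ne_zero, h0 _]
  have hne : ∀ z ∈ ({p, q}ᶜ : Set ℂ), z - p ≠ 0 ∧ z - q ≠ 0 := fun z hz =>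
    ⟨sub_ne_zero.2 fun e => hz (Or.inl e), sub_ne_zero.2 fun e => hz (Or.inr e)⟩
  have hmaps : MapsTo (fun z => (z - p) / (z - q)) {p, q}ᶜ {0}ᶜ := fun z hz =>
    div_ne_zero (hne z hz).1 (hne z hz).2
  refine ⟨k, fun z => l ((z - p) / (z - q)), hl.comp
    (ContinuousOn.div (by fun_prop) (by fun_prop) fun z hz => (hne z hz).2) hmaps, fun z hz => ?_⟩
  rw [hle _ (hmaps hz)]
  have hzq := (hne z hz).2
  have hw : (z - p) / (z - q) - 1 ≠ 0 := by
    rw [div_sub_one hzq]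
    exact div_ne_zero (by simpa using hqp) hzq
  simp only [hg]
  rw [if_neg (sub_ne_zero.1 hw)]
  have hM : (q * ((z - p) / (z - q)) - p) / ((z - p) / (z - q) - 1) = z := by
    rw [div_eq_iff hw]
    field_simp
    ring
  rw [hM]

lemma exists_cutoff {G J : Set ℂ} (hG : IsOpen G) (hJ : IsCompact J) {p q : ℂ} (hpJ : p ∈ J)
    (hpG : p ∉ G) (hJG : J \ {p, q} ⊆ G) :
    ∃ φ : ℂ → ℝ, ContinuousOn φ {p, q}ᶜ ∧ (∀ z, z ∉ J → z ∉ G → φ =ᶠ[𝓝 z] 0) ∧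
      (∀ z ∈ J, z ∈ G → φ =ᶠ[𝓝 z] 1) ∧ ∃ R, ∀ z, R < ‖z‖ → φ z = 0 := by
  have hGne : (Gᶜ).Nonempty := ⟨p, hpG⟩
  have hJne : J.Nonempty := ⟨p, hpJ⟩
  have hGc := continuous_infDist_pt (Gᶜ)
  have hJc := continuous_infDist_pt J
  have hle0 : ∀ z, 2 * infDist z Gᶜ ≤ 3 * infDist z J →
      max 0 (min 1 ((2 * infDist z Gᶜ - 3 * infDist z J) / (infDist z Gᶜ + infDist z J))) = 0 :=
    fun z hz => max_eq_left ((min_le_right _ _).trans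
      (div_nonpos_of_nonpos_of_nonneg (by linarith) (add_nonneg infDist_nonneg infDist_nonneg)))
  refine ⟨fun z => max 0 (min 1 ((2 * infDist z Gᶜ - 3 * infDist z J) /
    (infDist z Gᶜ + infDist z J))), ?_, fun z hzJ hzG => ?_, fun z hzJ hzG => ?_, ?_⟩
  · refine continuousOn_const.sup (continuousOn_const.inf (ContinuousOn.div (by fun_prop)
      (by fun_prop) fun z hz e => hz ?_))
    by_contra hn
    have hG0 : 0 ≤ infDist z Gᶜ := infDist_nonneg
    have hJ0 : 0 ≤ infDist z J := infDist_nonneg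
    have h1 : infDist z Gᶜ = 0 := by linarith
    have h2 : infDist z J = 0 := by linarith
    exact (hG.isClosed_compl.mem_iff_infDist_zero hGne).2 h1
      (hJG ⟨(hJ.isClosed.mem_iff_infDist_zero hJne).2 h2, hn⟩)
  · have h1 : infDist z Gᶜ = 0 := infDist_zero_of_mem hzG
    have h2 : 0 < infDist z J := (hJ.isClosed.notMem_iff_infDist_pos hJne).1 hzJ
    have h3 : ∀ᶠ w in 𝓝 z, 2 * infDist w Gᶜ < 3 * infDist w J :=
      ContinuousAt.eventually_lt (by fun_prop) (by fun_prop) (by rw [h1]; linarith)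
    filter_upwards [h3] with w hw
    exact hle0 w hw.le
  · have h1 : infDist z J = 0 := infDist_zero_of_mem hzJ
    have h2 : 0 < infDist z Gᶜ :=
      (hG.isClosed_compl.notMem_iff_infDist_pos hGne).1 (not_not.2 hzG)
    have h3 : ∀ᶠ w in 𝓝 z, 4 * infDist w J < infDist w Gᶜ :=
      ContinuousAt.eventually_lt (by fun_prop) (by fun_prop) (by rw [h1]; linarith)
    filter_upwards [h3] with w hw
    have h4 : 0 ≤ infDist w J := infDist_nonneg
    have h5 : 1 ≤ (2 * infDist w Gᶜ - 3 * infDist w J) / (infDist w Gᶜ + infDist w J) := by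
      rw [le_div_iff₀ (by linarith)]
      linarith
    simp [min_eq_left h5]
  · obtain ⟨R, hR⟩ := hJ.isBounded.exists_norm_le
    refine ⟨5 * R, fun z hz => hle0 z ?_⟩
    have h1 : infDist z Gᶜ ≤ ‖z‖ + R := by
      refine (infDist_le_dist_of_mem hpG).trans ?_
      rw [dist_eq_norm]
      linarith [norm_sub_le z p, hR p hpJ]
    have h2 : ‖z‖ - R ≤ infDist z J := by
      refine (le_infDist hJne).2 fun y hy => ?_
      rw [dist_eq_norm]
      linarith [norm_sub_norm_le z y, hR y hy]
    linarith

section Twist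

variable {G J : Set ℂ} {p q : ℂ} {φ : ℂ → ℝ} {n : ℂ → ℤ}

lemma continuousOn_cutoff_mul (hG : IsOpen G) (hJ : IsClosed J) (hφ : ContinuousOn φ {p, q}ᶜ)
    (hpJ : p ∈ J) (hqJ : q ∈ J) (hφ0 : ∀ z, z ∉ J → z ∉ G → φ =ᶠ[𝓝 z] 0)
    (hn : ContinuousOn n (G \ J)) :
    ContinuousOn (fun z => (φ z * n z : ℂ) * (2 * Real.pi * Complex.I)) Jᶜ := by
  intro z hz
  refine ContinuousAt.continuousWithinAt ?_
  refine ContinuousAt.mul ?_ continuousAt_const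
  by_cases hzG : z ∈ G
  · have h1 : ContinuousAt n z := hn.continuousAt ((hG.sdiff hJ).mem_nhds ⟨hzG, hz⟩)
    have h2 : ContinuousAt φ z := hφ.continuousAt ((toFinite _).isClosed.isOpen_compl.mem_nhds (by
      rintro (rfl | rfl) <;> contradiction))
    exact (Complex.continuous_ofReal.continuousAt.comp h2).mul
      ((continuous_of_discreteTopology (f := fun k : ℤ => (k : ℂ))).continuousAt.comp h1)
  · refine (continuousAt_const (y := (0 : ℂ))).congr ?_
    filter_upwards [hφ0 z hz hzG] with w hw
    simp [hw]

lemma continuousOn_cutoff_sub_one_mul (hG : IsOpen G) (hJ : IsClosed J)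
    (hφ : ContinuousOn φ {p, q}ᶜ) (hpG : p ∉ G) (hqG : q ∉ G)
    (hφ1 : ∀ z ∈ J, z ∈ G → φ =ᶠ[𝓝 z] 1) (hn : ContinuousOn n (G \ J)) :
    ContinuousOn (fun z => ((φ z - 1) * n z : ℂ) * (2 * Real.pi * Complex.I)) G := by
  intro z hz
  refine ContinuousAt.continuousWithinAt ?_
  refine ContinuousAt.mul ?_ continuousAt_const
  by_cases hzJ : z ∈ J
  · refine (continuousAt_const (y := (0 : ℂ))).congr ?_
    filter_upwards [hφ1 z hzJ hz] with w hw
    simp [hw]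
  · have h1 : ContinuousAt n z := hn.continuousAt ((hG.sdiff hJ).mem_nhds ⟨hz, hzJ⟩)
    have h2 : ContinuousAt φ z := hφ.continuousAt ((toFinite _).isClosed.isOpen_compl.mem_nhds (by
      rintro (rfl | rfl) <;> contradiction))
    exact ((Complex.continuous_ofReal.continuousAt.comp h2).sub continuousAt_const).mul
      ((continuous_of_discreteTopology (f := fun k : ℤ => (k : ℂ))).continuousAt.comp h1)

lemma exp_cutoff_sub_one_mul (t : ℝ) (k : ℤ) :
    Complex.exp (((t - 1) * k : ℂ) * (2 * Real.pi * Complex.I)) =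
      Complex.exp ((t * k : ℂ) * (2 * Real.pi * Complex.I)) := by
  rw [Complex.exp_eq_exp_iff_exists_int]
  exact ⟨-k, by push_cast; ring⟩

lemma continuousOn_exp_cutoff_mul (hG : IsOpen G) (hJ : IsClosed J) (hφ : ContinuousOn φ {p, q}ᶜ)
    (hpJ : p ∈ J) (hqJ : q ∈ J) (hpG : p ∉ G) (hqG : q ∉ G) (hJG : J \ {p, q} ⊆ G)
    (hφ0 : ∀ z, z ∉ J → z ∉ G → φ =ᶠ[𝓝 z] 0) (hφ1 : ∀ z ∈ J, z ∈ G → φ =ᶠ[𝓝 z] 1)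
    (hn : ContinuousOn n (G \ J)) :
    ContinuousOn (fun z => Complex.exp ((φ z * n z : ℂ) * (2 * Real.pi * Complex.I))) {p, q}ᶜ := by
  have h1 := (continuousOn_cutoff_mul hG hJ hφ hpJ hqJ hφ0 hn).cexp
  have h2 := (continuousOn_cutoff_sub_one_mul hG hJ hφ hpG hqG hφ1 hn).cexp
  simp only [exp_cutoff_sub_one_mul] at h2
  refine (h1.union_of_isOpen h2 hJ.isOpen_compl hG).mono fun z hz => ?_
  by_cases hzJ : z ∈ J
  · exact Or.inr (hJG ⟨hzJ, hz⟩)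
  · exact Or.inl hzJ

lemma eq_of_hasLogOn_exp_cutoff_mul (hG : IsOpen G) (hJ : IsClosed J)
    (hφ : ContinuousOn φ {p, q}ᶜ) (hGc : IsPreconnected G) (hJc : IsPreconnected Jᶜ)
    (hpJ : p ∈ J) (hqJ : q ∈ J) (hpG : p ∉ G) (hqG : q ∉ G)
    (hφ0 : ∀ z, z ∉ J → z ∉ G → φ =ᶠ[𝓝 z] 0) (hφ1 : ∀ z ∈ J, z ∈ G → φ =ᶠ[𝓝 z] 1)
    (hn : ContinuousOn n (G \ J))
    (h : HasLogOn (fun z => Complex.exp ((φ z * n z : ℂ) * (2 * Real.pi * Complex.I))) {p, q}ᶜ)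
    {x y : ℂ} (hx : x ∈ G \ J) (hy : y ∈ G \ J) : n x = n y := by
  obtain ⟨l, hl, hle⟩ := h
  have hJs : Jᶜ ⊆ {p, q}ᶜ := compl_subset_compl.2 (by rintro z (rfl | rfl) <;> assumption)
  have hGs : G ⊆ {p, q}ᶜ := by rintro z hz (rfl | rfl) <;> contradiction
  have h1 := continuous_log_sub_const hJc (hl.mono hJs)
    (continuousOn_cutoff_mul hG hJ hφ hpJ hqJ hφ0 hn) (fun z hz => hle z (hJs hz)) hx.2 hy.2
  have h2 := continuous_log_sub_const hGc (hl.mono hGs)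
    (continuousOn_cutoff_sub_one_mul hG hJ hφ hpG hqG hφ1 hn)
    (fun z hz => (hle z (hGs hz)).trans (exp_cutoff_sub_one_mul _ _).symm) hx.1 hy.1
  have h3 : ((n x : ℂ) - n y) * (2 * Real.pi * Complex.I) = 0 := by linear_combination h2 - h1
  exact_mod_cast sub_eq_zero.1 ((mul_eq_zero.1 h3).resolve_right Complex.two_pi_I_ne_zero)

end Twist

/-- Two locally constant integer valued functions on the complement of a crosscut have a linear
combination that is constant. -/
lemma exists_locallyConstant_relation {G : Set ℂ} (hG : IsOpen G) (hGc : IsPreconnected G)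
    {f : I → ℂ} (hf : Continuous f) (hinj : Function.Injective f) (h0 : f 0 ∉ G) (h1 : f 1 ∉ G)
    (hfG : range f \ {f 0, f 1} ⊆ G) {m n : ℂ → ℤ} (hm : ContinuousOn m (G \ range f))
    (hn : ContinuousOn n (G \ range f)) :
    ∃ j k : ℤ, (∀ x ∈ G \ range f, ∀ y ∈ G \ range f, k * m x - j * n x = k * m y - j * n y) ∧
      (j = 0 → ∀ x ∈ G \ range f, ∀ y ∈ G \ range f, m x = m y) := by
  have hpq : f 0 ≠ f 1 := fun e => zero_ne_one (hinj e)
  have hJ := isCompact_range hf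
  have hJc := isPreconnected_compl_range hf hinj
  have hp := mem_range_self (f := f) 0
  have hq := mem_range_self (f := f) 1
  obtain ⟨φ, hφ, hφ0, hφ1, R, hR⟩ := exists_cutoff hG hJ hp h0 hfG
  have key : ∀ n : ℂ → ℤ, ContinuousOn n (G \ range f) → ∃ k : ℤ, HasLogOn (fun z =>
      Complex.exp ((φ z * n z : ℂ) * (2 * Real.pi * Complex.I)) *
        ((z - f 0) / (z - f 1)) ^ k) {f 0, f 1}ᶜ := fun n hn =>
    exists_hasLogOn_mul_zpow_compl_pair (R := R) hpq (continuousOn_exp_cutoff_mul hG hJ.isClosed hφ hp hq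
      h0 h1 hfG hφ0 hφ1 hn) (fun z => Complex.exp_ne_zero _) fun z hz => by simp [hR z hz]
  have key2 : ∀ n : ℂ → ℤ, ContinuousOn n (G \ range f) → HasLogOn (fun z =>
      Complex.exp ((φ z * n z : ℂ) * (2 * Real.pi * Complex.I))) {f 0, f 1}ᶜ →
      ∀ x ∈ G \ range f, ∀ y ∈ G \ range f, n x = n y := fun n hn hlog x hx y hy =>
    eq_of_hasLogOn_exp_cutoff_mul hG hJ.isClosed hφ hGc hJc hp hq h0 h1 hφ0 hφ1 hn hlog hx hy
  obtain ⟨j, lm, hlm, hlme⟩ := key m hm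
  obtain ⟨k, ln, hln, hlne⟩ := key n hn
  refine ⟨j, k, key2 (fun z => k * m z - j * n z) ?_ ⟨fun z => k * lm z - j * ln z,
    (continuousOn_const.mul hlm).sub (continuousOn_const.mul hln), fun z hz => ?_⟩, ?_⟩
  · exact (continuousOn_const.mul hm).sub (continuousOn_const.mul hn)
  · have hw : (z - f 0) / (z - f 1) ≠ 0 := div_ne_zero (sub_ne_zero.2 fun e => hz (Or.inl e))
      (sub_ne_zero.2 fun e => hz (Or.inr e))
    rw [Complex.exp_sub, Complex.exp_int_mul, Complex.exp_int_mul, hlme z hz, hlne z hz,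
      mul_zpow, mul_zpow, ← zpow_mul, ← zpow_mul, mul_comm k j, mul_div_mul_right _ _
      (zpow_ne_zero _ hw), ← Complex.exp_int_mul, ← Complex.exp_int_mul, ← Complex.exp_sub]
    congr 1
    push_cast
    ring
  · rintro rfl
    exact key2 m hm ⟨lm, hlm, fun z hz => by simpa using hlme z hz⟩

lemma continuousOn_indicator_one_int {X : Type*} [TopologicalSpace X] {S U : Set X}
    (hU : IsOpen U) (hU' : IsOpen (S \ U)) : ContinuousOn (U.indicator (1 : X → ℤ)) S := by
  intro x hx
  refine ContinuousAt.continuousWithinAt ?_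
  by_cases hxU : x ∈ U
  · refine (continuousAt_const (y := (1 : ℤ))).congr ?_
    filter_upwards [hU.mem_nhds hxU] with y hy
    simp [hy]
  · refine (continuousAt_const (y := (0 : ℤ))).congr ?_
    filter_upwards [hU'.mem_nhds ⟨hx, hxU⟩] with y hy
    simp [hy.2]

/-- The complement of a crosscut in a domain is the union of any two of its components. -/
lemma diff_range_subset_union {G : Set ℂ} (hG : IsOpen G) (hGc : IsPreconnected G)
    {f : I → ℂ} (hf : Continuous f) (hinj : Function.Injective f) (h0 : f 0 ∉ G) (h1 : f 1 ∉ G)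
    (hfG : range f \ {f 0, f 1} ⊆ G) {U V : Set ℂ} (hU : IsOpen U) (hV : IsOpen V)
    (hU' : IsOpen ((G \ range f) \ U)) (hV' : IsOpen ((G \ range f) \ V)) (hd : Disjoint U V)
    (hUn : (U ∩ (G \ range f)).Nonempty) (hVn : (V ∩ (G \ range f)).Nonempty) :
    G \ range f ⊆ U ∪ V := by
  intro z hz
  by_contra hzUV
  rw [mem_union, not_or] at hzUV
  obtain ⟨x, hxU, hx⟩ := hUn
  obtain ⟨y, hyV, hy⟩ := hVn
  obtain ⟨j, k, h, hj⟩ := exists_locallyConstant_relation hG hGc hf hinj h0 h1 hfG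
    (continuousOn_indicator_one_int hU hU') (continuousOn_indicator_one_int hV hV')
  have e1 := h y hy z hz
  have hyU : y ∉ U := disjoint_right.1 hd hyV
  simp only [indicator_of_notMem hyU, indicator_of_mem hyV, indicator_of_notMem hzUV.1,
    indicator_of_notMem hzUV.2, Pi.one_apply] at e1
  have e2 := hj (by lia) x hx z hz
  simp only [indicator_of_mem hxU, indicator_of_notMem hzUV.1, Pi.one_apply] at e2
  exact one_ne_zero e2

/-- A component of the complement of a crosscut in a simply connected domain is simply
connected. -/
lemma simplyConnectedSpace_of_union_eq_diff_range {G : Set ℂ} (hG : IsOpen G)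
    (hGs : SimplyConnectedSpace G) {f : I → ℂ} (hf : Continuous f) (h0 : f 0 ∉ G) {U V : Set ℂ}
    (hU : IsOpen U) (hV : IsOpen V) (hUc : IsConnected U) (hd : Disjoint U V)
    (hUV : U ∪ V = G \ range f) : SimplyConnectedSpace U := by
  have hUG : U ⊆ G := fun z hz => (hUV.subset (Or.inl hz)).1
  have hVG : V ⊆ G := fun z hz => (hUV.subset (Or.inr hz)).1
  have hlog : ∀ a ∉ G, HasLogOn (fun z => z - a) U := fun a ha =>
    (hasLogOn_of_simplyConnected hGs hG (g := fun z => z - a) (by fun_prop)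
      fun z hz => sub_ne_zero.2 fun e => ha (e ▸ hz)).mono hUG
  refine simplyConnectedSpace_of_hasLogOn hU hUc (fun e => h0 (hUG (e ▸ mem_univ _))) fun a ha =>
    hasLogOn_sub_of_disjoint hU hV hd (fun e => h0 (hVG (e ▸ mem_univ _))) (fun b hb => ?_) ha
  by_cases hbG : b ∈ G
  swap
  · exact hlog b hbG
  rw [hUV, Set.mem_sdiff, not_and, not_not] at hb
  obtain ⟨s, rfl⟩ := hb hbG
  exact hasLogOn_sub_of_path (fun t => f (t * s)) (by fun_prop) (by simp) (by simp)
    (fun t ht => (hUV.subset (Or.inl ht)).2 ⟨_, rfl⟩) (hlog _ h0)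

lemma isOpen_diff_connectedComponentIn {S : Set ℂ} (hS : IsOpen S) (x : ℂ) :
    IsOpen (S \ connectedComponentIn S x) := by
  have : S \ connectedComponentIn S x =
      ⋃ y ∈ S \ connectedComponentIn S x, connectedComponentIn S y := by
    refine Subset.antisymm (fun y hy => mem_biUnion hy (mem_connectedComponentIn hy.1))
      (iUnion₂_subset fun y hy z hz => ⟨connectedComponentIn_subset _ _ hz, fun hzx => hy.2 ?_⟩)
    rw [connectedComponentIn_eq hzx, ← connectedComponentIn_eq hz]
    exact mem_connectedComponentIn hy.1
  rw [this]
  exact isOpen_biUnion fun y _ => hS.connectedComponentIn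

/-- A crosscut of a simply connected domain separates it into two disjoint
nonempty open connected simply connected pieces. -/
theorem crosscut_separates (G J : Set ℂ) (hG : IsSCDomain G) (hJ : IsCrosscut G J) :
    ∃ U V : Set ℂ, Disjoint U V ∧ U.Nonempty ∧ V.Nonempty ∧
      IsOpen U ∧ IsConnected U ∧ SimplyConnectedSpace U ∧
      IsOpen V ∧ IsConnected V ∧ SimplyConnectedSpace V ∧
      G \ J = U ∪ V := by
  obtain ⟨hGo, hGc, -, hGs⟩ := hG
  obtain ⟨g, ⟨hgc, hgi, rfl⟩, h0, h1, hgG⟩ := hJ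
  obtain ⟨f, hf, hinj, hrange, hf0, hf1⟩ : ∃ f : I → ℂ, Continuous f ∧ Function.Injective f ∧
      g '' Icc 0 1 = range f ∧ f 0 = g 0 ∧ f 1 = g 1 :=
    ⟨fun t => g t, hgc.comp_continuous continuous_subtype_val fun t => t.2,
      fun s t h => Subtype.ext (hgi s.2 t.2 h), image_eq_range _ _, rfl, rfl⟩
  rw [hGo.frontier_eq] at h0 h1
  rw [← hf0] at h0
  rw [← hf1] at h1
  rw [hrange, ← hf0, ← hf1] at hgG
  rw [hrange]
  have hS : IsOpen (G \ range f) := hGo.sdiff (isCompact_range hf).isClosed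
  obtain ⟨x, hx, y, hy, hxy⟩ : ∃ x ∈ G \ range f, ∃ y ∈ G \ range f,
      y ∉ connectedComponentIn (G \ range f) x := by
    by_contra! h
    refine not_isPreconnected_diff_range hGo hGs hf hinj h0.2 h1.2 hgG
      (isPreconnected_of_forall_pair fun x hx y hy => ?_)
    exact ⟨_, connectedComponentIn_subset _ _, mem_connectedComponentIn hx, h x hx y hy,
      isPreconnected_connectedComponentIn⟩
  set U := connectedComponentIn (G \ range f) x with hU
  set V := connectedComponentIn (G \ range f) y with hV
  have hxU : x ∈ U := mem_connectedComponentIn hx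
  have hyV : y ∈ V := mem_connectedComponentIn hy
  have hUo : IsOpen U := hS.connectedComponentIn
  have hVo : IsOpen V := hS.connectedComponentIn
  have hUc : IsConnected U := ⟨⟨x, hxU⟩, isPreconnected_connectedComponentIn⟩
  have hVc : IsConnected V := ⟨⟨y, hyV⟩, isPreconnected_connectedComponentIn⟩
  have hd : Disjoint U V := disjoint_left.2 fun z hzU hzV => hxy <| by
    rw [hU, connectedComponentIn_eq hzU, ← connectedComponentIn_eq hzV]
    exact hyV
  have hUV : U ∪ V = G \ range f := Subset.antisymm
    (union_subset (connectedComponentIn_subset _ _) (connectedComponentIn_subset _ _))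
    (diff_range_subset_union hGo hGc.isPreconnected hf hinj h0.2 h1.2 hgG hUo hVo
      (isOpen_diff_connectedComponentIn hS x) (isOpen_diff_connectedComponentIn hS y) hd
      ⟨x, hxU, hx⟩ ⟨y, hyV, hy⟩)
  exact ⟨U, V, hd, hUc.nonempty, hVc.nonempty, hUo, hUc,
    simplyConnectedSpace_of_union_eq_diff_range hGo hGs hf h0.2 hUo hVo hUc hd hUV, hVo, hVc,
    simplyConnectedSpace_of_union_eq_diff_range hGo hGs hf h0.2 hVo hUo hVc hd.symm
      ((union_comm _ _).trans hUV), hUV.symm⟩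
end

section
/- Let φ be a Riemann map of a simply connected domain G in ℂ, and let a, b be two distinct accessible points of ∂G. If J₁ and J₂ are Jordan arcs contained in closure(G) with J₁ ∩ ∂G = {a} and J₂ ∩ ∂G = {b}, then the limit of φ along J₁ at a is different from the limit of φ along J₂ at b. -/
open Set Topology Metric Filter

open MeasureTheory

theorem AnalyticOnNhd.map_nhds_of_injOn {f : ℂ → ℂ} {G : Set ℂ} (hG : IsOpen G)
    (hf : AnalyticOnNhd ℂ f G) (hinj : InjOn f G) {p : ℂ} (hp : p ∈ G) :
    map f (𝓝 p) = 𝓝 (f p) := by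
  refine le_antisymm (hf p hp).continuousAt ?_
  refine (hf p hp).eventually_constant_or_nhds_le_map_nhds.resolve_left fun h ↦ ?_
  have h' : ∀ᶠ z in 𝓝[≠] p, f z = f p ∧ z ∈ G :=
    nhdsWithin_le_nhds (h.and (hG.mem_nhds hp))
  obtain ⟨z, ⟨hz, hzG⟩, hzp⟩ := (h'.and self_mem_nhdsWithin).exists
  exact hzp (hinj hzG hp hz)

theorem AnalyticOnNhd.differentiableAt_leftInverse {f g : ℂ → ℂ} {G : Set ℂ} (hG : IsOpen G)
    (hf : AnalyticOnNhd ℂ f G) (hinj : InjOn f G) (hg : LeftInvOn g f G) {p : ℂ} (hp : p ∈ G) :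
    DifferentiableAt ℂ g (f p) := by
  have himg {U : Set ℂ} {z : ℂ} (hz : z ∈ G) (hU : U ∈ 𝓝 z) : f '' U ∈ 𝓝 (f z) := by
    rw [← hf.map_nhds_of_injOn hG hinj hz]
    exact image_mem_map hU
  have hcont {z : ℂ} (hz : z ∈ G) : ContinuousAt g (f z) := by
    intro U hU
    rw [hg hz] at hU
    rw [mem_map]
    filter_upwards [himg hz (inter_mem hU (hG.mem_nhds hz))]
    rintro _ ⟨x, ⟨hxU, hxG⟩, rfl⟩
    rwa [mem_preimage, hg hxG]
  have hdiff {z : ℂ} (hz : z ∈ G) (h0 : deriv f z ≠ 0) : DifferentiableAt ℂ g (f z) := by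
    refine (HasDerivAt.of_local_left_inverse (f := f) (hcont hz) ?_ h0 ?_).differentiableAt
    · rw [hg hz]
      exact (hf z hz).differentiableAt.hasDerivAt
    · filter_upwards [himg hz (hG.mem_nhds hz)]
      rintro _ ⟨x, hx, rfl⟩
      rw [hg hx]
  have hev : ∀ᶠ z in 𝓝[≠] p, deriv f z ≠ 0 := by
    refine (hf p hp).deriv.eventually_eq_zero_or_eventually_ne_zero.resolve_left fun h ↦ ?_
    obtain ⟨r, hr, hball⟩ := Metric.mem_nhds_iff.1 (inter_mem h (hG.mem_nhds hp))
    have hconst : ∀ z ∈ ball p r, f z = f p := fun z hz ↦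
      isOpen_ball.is_const_of_deriv_eq_zero (convex_ball p r).isPreconnected
        (fun z hz ↦ (hf z (hball hz).2).differentiableAt.differentiableWithinAt)
        (fun z hz ↦ (hball hz).1) hz (mem_ball_self hr)
    have h' : ∀ᶠ z in 𝓝[≠] p, z ∈ ball p r := nhdsWithin_le_nhds (ball_mem_nhds p hr)
    obtain ⟨z, hz, hzp⟩ := (h'.and self_mem_nhdsWithin).exists
    exact hzp (hinj (hball hz).2 hp (hconst z hz))
  refine (Complex.analyticAt_of_differentiable_on_punctured_nhds_of_continuousAt ?_
    (hcont hp)).differentiableAt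
  rw [eventually_nhdsWithin_iff] at hev ⊢
  filter_upwards [himg hp (inter_mem hev (hG.mem_nhds hp))]
  rintro _ ⟨x, ⟨hx, hxG⟩, rfl⟩ hxp
  exact hdiff hxG (hx fun h ↦ hxp (by rw [mem_singleton_iff.1 h]; rfl))

theorem lintegral_enorm_deriv_sq_eq_volume_image {ψ : ℂ → ℂ} {T : Set ℂ} (hT : IsOpen T)
    (hψ : DifferentiableOn ℂ ψ T) (hinj : InjOn ψ T) :
    ∫⁻ z in T, ‖deriv ψ z‖ₑ ^ 2 = volume (ψ '' T) := by
  rw [← lintegral_abs_det_fderiv_eq_addHaar_image volume hT.measurableSet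
    (fun z hz ↦ ((hψ.hasDerivAt (hT.mem_nhds hz)).hasFDerivAt.restrictScalars ℝ).hasFDerivWithinAt)
    hinj]
  refine lintegral_congr fun z ↦ ?_
  have : (ContinuousLinearMap.restrictScalars ℝ
      (ContinuousLinearMap.toSpanSingleton ℂ (deriv ψ z))).det = ‖deriv ψ z‖ ^ 2 := by
    rw [ContinuousLinearMap.det, ContinuousLinearMap.coe_restrictScalars,
      LinearMap.det_restrictScalars]
    simp [Algebra.norm_complex_eq, Complex.normSq_eq_norm_sq]
  rw [this, abs_of_nonneg (by positivity), ENNReal.ofReal_pow (by positivity), ofReal_norm]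

theorem enorm_sub_le_lintegral_vertical_segment {ψ : ℂ → ℂ} {S B : Set ℂ} {u : ℂ → ℝ}
    {C : ENNReal} (hS : IsOpen S) (hψ : DifferentiableOn ℂ ψ S) (hu : ContDiff ℝ 1 u)
    (hC : ∀ z, ‖fderiv ℝ u z‖ₑ ≤ C) (hB : ∀ z ∉ B, fderiv ℝ u z = 0) {x y₁ y₂ : ℝ}
    (hseg : ∀ y ∈ uIcc y₁ y₂, (x + y * Complex.I : ℂ) ∈ S) :
    ‖u (ψ (x + y₂ * Complex.I)) - u (ψ (x + y₁ * Complex.I))‖ₑ ≤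
      ∫⁻ y in uIoc y₁ y₂, C * (S ∩ ψ ⁻¹' B).indicator (fun z ↦ ‖deriv ψ z‖ₑ)
        (x + y * Complex.I) := by
  set l : ℝ → ℂ := fun y ↦ x + y * Complex.I
  have hl : Continuous l := by fun_prop
  have hl' (y : ℝ) : HasDerivAt l Complex.I y := by
    simpa [l] using ((Complex.ofRealCLM.hasDerivAt (x := y)).mul_const Complex.I).const_add (x : ℂ)
  have hder : ∀ y ∈ uIcc y₁ y₂, HasDerivAt (fun y ↦ u (ψ (l y)))
      (fderiv ℝ u (ψ (l y)) (deriv ψ (l y) * Complex.I)) y := fun y hy ↦ by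
    have h1 : HasDerivAt (fun y ↦ ψ (l y)) (deriv ψ (l y) * Complex.I) y :=
      (hψ.hasDerivAt (hS.mem_nhds (hseg y hy))).comp y (hl' y)
    exact ((hu.differentiable one_ne_zero) _).hasFDerivAt.comp_hasDerivAt y h1
  have hcont : ContinuousOn (fun y ↦ fderiv ℝ u (ψ (l y)) (deriv ψ (l y) * Complex.I))
      (uIcc y₁ y₂) := by
    have h1 : ContinuousOn (fun y ↦ ψ (l y)) (uIcc y₁ y₂) :=
      hψ.continuousOn.comp hl.continuousOn hseg
    have h2 : ContinuousOn (fun y ↦ deriv ψ (l y)) (uIcc y₁ y₂) :=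
      (hψ.deriv hS).continuousOn.comp hl.continuousOn hseg
    exact ((hu.continuous_fderiv one_ne_zero).comp_continuousOn h1).clm_apply
      (h2.mul continuousOn_const)
  rw [← intervalIntegral.integral_eq_sub_of_hasDerivAt hder hcont.intervalIntegrable,
    ← ofReal_norm, intervalIntegral.norm_integral_eq_norm_integral_uIoc, ofReal_norm]
  refine (enorm_integral_le_lintegral_enorm _).trans
    (setLIntegral_mono' measurableSet_uIoc fun y hy ↦ ?_)
  have hyS : l y ∈ S := hseg y (uIoc_subset_uIcc hy)
  by_cases hyB : ψ (l y) ∈ B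
  · rw [indicator_of_mem (show l y ∈ S ∩ ψ ⁻¹' B from ⟨hyS, hyB⟩)]
    refine (ContinuousLinearMap.le_opENorm _ _).trans ?_
    rw [enorm_mul]
    gcongr
    · exact hC _
    · simp [enorm_eq_nnnorm]
  · simp [hB _ hyB]

theorem inv_le_lintegral_sq_of_one_le {α : Type*} [MeasurableSpace α] {μ : Measure α}
    {s : Set α} {q : α → ENNReal} {C A : ENNReal} (hq : Measurable q) (hA : μ s ≤ A)
    (h : 1 ≤ ∫⁻ y in s, C * q y ∂μ) : (C ^ 2 * A)⁻¹ ≤ ∫⁻ y, q y ^ 2 ∂μ := by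
  have hH := ENNReal.lintegral_mul_le_Lp_mul_Lq (μ.restrict s) Real.HolderConjugate.two_two
    (f := fun _ ↦ C) (g := q) aemeasurable_const hq.aemeasurable
  rw [← ENNReal.mul_rpow_of_nonneg _ _ (by norm_num)] at hH
  simp only [Pi.mul_apply, ENNReal.rpow_ofNat, lintegral_const, Measure.restrict_apply_univ] at hH
  have h1 : 1 ≤ C ^ 2 * μ s * ∫⁻ y in s, q y ^ 2 ∂μ := by
    by_contra! hlt
    exact (h.trans hH).not_gt (ENNReal.rpow_lt_one hlt (by norm_num))
  rw [← one_div]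
  refine ENNReal.div_le_of_le_mul' (h1.trans ?_)
  gcongr
  exact Measure.restrict_le_self

theorem not_forall_exists_vertical_segment {ψ : ℂ → ℂ} {S B : Set ℂ} {u : ℂ → ℝ}
    {C : ENNReal} (hS : IsOpen S) (him : ∀ z ∈ S, |z.im| ≤ Real.pi / 2)
    (hψ : DifferentiableOn ℂ ψ S) (hinj : InjOn ψ S) (hu : ContDiff ℝ 1 u)
    (hC : ∀ z, ‖fderiv ℝ u z‖ₑ ≤ C) (hC' : C ≠ ⊤) (hBo : IsOpen B) (hBv : volume B ≠ ⊤)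
    (hB : ∀ z ∉ B, fderiv ℝ u z = 0) (M : ℝ) :
    ¬ ∀ x ≤ M, ∃ y₁ y₂ : ℝ, (∀ y ∈ uIcc y₁ y₂, (x + y * Complex.I : ℂ) ∈ S) ∧
      1 ≤ ‖u (ψ (x + y₂ * Complex.I)) - u (ψ (x + y₁ * Complex.I))‖ₑ := by
  intro h
  have hT : IsOpen (S ∩ ψ ⁻¹' B) := hψ.continuousOn.isOpen_inter_preimage hS hBo
  set q : ℂ → ENNReal := (S ∩ ψ ⁻¹' B).indicator (fun z ↦ ‖deriv ψ z‖ₑ) with hq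
  have hqm : Measurable q := ((measurable_deriv ψ).enorm).indicator hT.measurableSet
  have hfin : ∫⁻ z, q z ^ 2 < ⊤ := by
    have h1 : ∀ z, q z ^ 2 = (S ∩ ψ ⁻¹' B).indicator (fun z ↦ ‖deriv ψ z‖ₑ ^ 2) z := fun z ↦ by
      by_cases hz : z ∈ S ∩ ψ ⁻¹' B <;> simp [hq, hz]
    simp_rw [h1]
    rw [lintegral_indicator hT.measurableSet,
      lintegral_enorm_deriv_sq_eq_volume_image hT (hψ.mono inter_subset_left)
        (hinj.mono inter_subset_left)]
    exact (measure_mono (image_subset_iff.2 inter_subset_right)).trans_lt hBv.lt_top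
  have hfub : ∫⁻ z, q z ^ 2 = ∫⁻ x : ℝ, ∫⁻ y : ℝ, q (x + y * Complex.I) ^ 2 := by
    rw [← Complex.volume_preserving_equiv_real_prod.symm.lintegral_comp (hqm.pow_const 2),
      Measure.volume_eq_prod, lintegral_prod _ (by fun_prop)]
    simp [Complex.mk_eq_add_mul_I]
  have hslice : ∀ x ≤ M,
      (C ^ 2 * ENNReal.ofReal Real.pi)⁻¹ ≤ ∫⁻ y : ℝ, q (x + y * Complex.I) ^ 2 := fun x hx ↦ by
    obtain ⟨y₁, y₂, hseg, hosc⟩ := h x hx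
    refine inv_le_lintegral_sq_of_one_le (s := uIoc y₁ y₂) (by fun_prop) ?_
      (hosc.trans (enorm_sub_le_lintegral_vertical_segment hS hψ hu hC hB hseg))
    rw [Real.volume_uIoc]
    refine ENNReal.ofReal_le_ofReal ?_
    have h1 := him _ (hseg y₁ left_mem_uIcc)
    have h2 := him _ (hseg y₂ right_mem_uIcc)
    simp only [Complex.add_im, Complex.ofReal_im, Complex.mul_im, Complex.ofReal_re,
      Complex.I_re, Complex.I_im, mul_one, mul_zero, add_zero, zero_add] at h1 h2
    rw [abs_le] at *
    constructor <;> linarith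
  refine hfin.not_ge ?_
  calc ⊤ = ∫⁻ x in Iic M, (C ^ 2 * ENNReal.ofReal Real.pi)⁻¹ := by
        rw [lintegral_const, Measure.restrict_apply_univ, Real.volume_Iic, ENNReal.mul_top]
        exact ENNReal.inv_ne_zero.2
          (ENNReal.mul_ne_top (ENNReal.pow_ne_top hC') ENNReal.ofReal_ne_top)
    _ ≤ ∫⁻ x in Iic M, ∫⁻ y : ℝ, q (x + y * Complex.I) ^ 2 :=
        setLIntegral_mono' measurableSet_Iic hslice
    _ ≤ ∫⁻ x : ℝ, ∫⁻ y : ℝ, q (x + y * Complex.I) ^ 2 := setLIntegral_le_lintegral _ _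
    _ = ∫⁻ z, q z ^ 2 := hfub.symm

theorem exp_vertical_mem_ball {x y : ℝ} :
    Complex.exp (x + y * Complex.I) ∈ ball (1 : ℂ) 1 ↔ Real.exp x < 2 * Real.cos y := by
  have h : ‖Complex.exp (x + y * Complex.I) - 1‖ ^ 2 =
      1 + Real.exp x * (Real.exp x - 2 * Real.cos y) := by
    rw [Complex.sq_norm, Complex.normSq_apply]
    simp only [Complex.sub_re, Complex.sub_im, Complex.exp_re, Complex.exp_im, Complex.add_re,
      Complex.add_im, Complex.ofReal_re, Complex.ofReal_im, Complex.mul_re, Complex.mul_im,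
      Complex.I_re, Complex.I_im, Complex.one_re, Complex.one_im]
    ring_nf
    linear_combination Real.exp x ^ 2 * Real.sin_sq_add_cos_sq y
  rw [mem_ball_iff_norm, ← abs_norm, ← sq_lt_one_iff_abs_lt_one, h]
  have := Real.exp_pos x
  constructor
  · intro h; by_contra! h'; nlinarith
  · intro h; nlinarith

theorem exp_vertical_segment_mem_ball {x y₁ y₂ y : ℝ} (h₁ : |y₁| ≤ Real.pi / 2)
    (h₂ : |y₂| ≤ Real.pi / 2) (he₁ : Complex.exp (x + y₁ * Complex.I) ∈ ball (1 : ℂ) 1)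
    (he₂ : Complex.exp (x + y₂ * Complex.I) ∈ ball (1 : ℂ) 1) (hy : y ∈ uIcc y₁ y₂) :
    Complex.exp (x + y * Complex.I) ∈ ball (1 : ℂ) 1 := by
  rw [exp_vertical_mem_ball] at *
  have := strictConcaveOn_cos_Icc.concaveOn.min_le_of_mem_segment (x := y₁) (y := y₂) (z := y)
    (abs_le.1 h₁) (abs_le.1 h₂) (by rwa [segment_eq_uIcc])
  rcases min_le_iff.1 this with h | h <;> linarith

theorem IsJordanArc.exists_path {J : Set ℂ} {a : ℂ} (hJ : IsJordanArc J) (ha : a ∈ J) :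
    ∃ g : ℝ → ℂ, ContinuousOn g (Icc 0 1) ∧ g 0 = a ∧ ∀ t ∈ Ioc (0 : ℝ) 1, g t ∈ J \ {a} := by
  obtain ⟨f, hf, hinj, rfl⟩ := hJ
  obtain ⟨s, hs, rfl⟩ := ha
  obtain ⟨e, he, hes⟩ : ∃ e ∈ Icc (0 : ℝ) 1, e ≠ s := by
    by_cases h : s = 0
    · exact ⟨1, by simp, by simp [h]⟩
    · exact ⟨0, by simp, Ne.symm h⟩
  have hmem : ∀ t ∈ Icc (0 : ℝ) 1, s + t * (e - s) ∈ Icc (0 : ℝ) 1 := fun t ht ↦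
    ⟨by nlinarith [ht.1, ht.2, hs.1, he.1], by nlinarith [ht.1, ht.2, hs.2, he.2]⟩
  refine ⟨fun t ↦ f (s + t * (e - s)), hf.comp (by fun_prop) hmem, by simp, fun t ht ↦ ?_⟩
  have ht' := hmem t (Ioc_subset_Icc_self ht)
  refine ⟨mem_image_of_mem f ht', fun h ↦ ?_⟩
  have := hinj ht' hs h
  simp [ht.1.ne', sub_ne_zero.2 hes] at this

theorem IsJordanArc.exists_path_tendsto {J : Set ℂ} {a : ℂ} (hJ : IsJordanArc J) (ha : a ∈ J) :
    ∃ g : ℝ → ℂ, ContinuousOn g (Ioc 0 1) ∧ (∀ t ∈ Ioc (0 : ℝ) 1, g t ∈ J \ {a}) ∧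
      Tendsto g (𝓝[>] 0) (𝓝[J \ {a}] a) := by
  obtain ⟨g, hg, h0, hgJ⟩ := hJ.exists_path ha
  refine ⟨g, hg.mono Ioc_subset_Icc_self, hgJ, tendsto_nhdsWithin_iff.2 ⟨?_, ?_⟩⟩
  · have := hg 0 (by simp)
    rw [ContinuousWithinAt, h0] at this
    rw [← nhdsWithin_Ioc_eq_nhdsGT (zero_lt_one' ℝ)]
    exact this.mono_left (nhdsWithin_mono _ Ioc_subset_Icc_self)
  · filter_upwards [Ioc_mem_nhdsGT (zero_lt_one' ℝ)] using hgJ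

theorem IsJordanArc.exists_forall_le_exists_eq {J G U : Set ℂ} {a : ℂ} {l : ℂ → ℝ}
    (hJ : IsJordanArc J) (ha : a ∈ J) (hJG : J \ {a} ⊆ G) (hl : ContinuousOn l G)
    (hlim : Tendsto l (𝓝[J \ {a}] a) atBot) (hU : U ∈ 𝓝 a) :
    ∃ M, ∀ x ≤ M, ∃ z ∈ G ∩ U, l z = x := by
  obtain ⟨g, hg, hgJ, hga⟩ := hJ.exists_path_tendsto ha
  have hU' : ∀ᶠ t in 𝓝[>] 0, g t ∈ U := hga (nhdsWithin_le_nhds hU)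
  obtain ⟨d, hd, hdU⟩ := (mem_nhdsGT_iff_exists_Ioc_subset).1
    (inter_mem hU' (Ioc_mem_nhdsGT (zero_lt_one' ℝ)))
  refine ⟨l (g d), fun x hx ↦ ?_⟩
  obtain ⟨t, ht, htd⟩ :=
    (((hlim.comp hga).eventually_le_atBot x).and (Ioc_mem_nhdsGT hd)).exists
  have hsub : Icc t d ⊆ Ioc 0 d := fun y hy ↦ ⟨htd.1.trans_le hy.1, hy.2⟩
  have hcont : ContinuousOn (fun s ↦ l (g s)) (Icc t d) :=
    hl.comp (hg.mono fun y hy ↦ (hdU (hsub hy)).2) fun y hy ↦ hJG (hgJ y (hdU (hsub hy)).2)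
  obtain ⟨s, hs, hsx⟩ := intermediate_value_Icc htd.2 hcont ⟨ht, hx⟩
  exact ⟨g s, ⟨hJG (hgJ s (hdU (hsub hs)).2), (hdU (hsub hs)).1⟩, hsx⟩

theorem AnalyticOnNhd.notMem_image_of_tendsto {φ : ℂ → ℂ} {G s : Set ℂ} {a w : ℂ}
    (hG : IsOpen G) (hφ : AnalyticOnNhd ℂ φ G) (hinj : InjOn φ G) (hs : s ⊆ G) (ha : a ∉ G)
    [NeBot (𝓝[s] a)] (hw : Tendsto φ (𝓝[s] a) (𝓝 w)) : w ∉ φ '' G := by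
  rintro ⟨p, hp, rfl⟩
  obtain ⟨U, V, hU, hV, hpU, haV, hUV⟩ := t2_separation (ne_of_mem_of_not_mem hp ha)
  rw [← hφ.map_nhds_of_injOn hG hinj hp] at hw
  have h : ∀ᶠ z in 𝓝[s] a, φ z ∈ φ '' (U ∩ G) :=
    hw (image_mem_map (inter_mem (hU.mem_nhds hpU) (hG.mem_nhds hp)))
  have hV' : ∀ᶠ z in 𝓝[s] a, z ∈ V := nhdsWithin_le_nhds (hV.mem_nhds haV)
  obtain ⟨z, ⟨⟨y, ⟨hyU, hyG⟩, hyz⟩, hzs⟩, hzV⟩ := ((h.and self_mem_nhdsWithin).and hV').exists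
  obtain rfl := hinj hyG (hs hzs) hyz
  exact disjoint_left.1 hUV hyU hzV

theorem IsRiemannMap.norm_eq_one_of_tendsto {φ : ℂ → ℂ} {G s : Set ℂ} {a w : ℂ}
    (hG : IsOpen G) (hφ : IsRiemannMap G φ) (hs : s ⊆ G) (ha : a ∉ G)
    [NeBot (𝓝[s] a)] (hw : Tendsto φ (𝓝[s] a) (𝓝 w)) : ‖w‖ = 1 := by
  have h1 : w ∉ ball (0 : ℂ) 1 := hφ.2.2 ▸ hφ.1.notMem_image_of_tendsto hG hφ.2.1 hs ha hw
  have h2 : w ∈ closedBall (0 : ℂ) 1 := isClosed_closedBall.mem_of_tendsto hw <| by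
    filter_upwards [self_mem_nhdsWithin] with z hz
    exact ball_subset_closedBall (hφ.2.2 ▸ mem_image_of_mem φ (hs hz))
  rw [mem_ball_zero_iff] at h1
  rw [mem_closedBall_zero_iff] at h2
  exact h2.antisymm (not_lt.1 h1)

theorem exists_contDiff_eq_one_eq_zero {a b : ℂ} (hab : a ≠ b) :
    ∃ u : ℂ → ℝ, ContDiff ℝ 1 u ∧ (∀ᶠ z in 𝓝 a, u z = 1) ∧ (∀ᶠ z in 𝓝 b, u z = 0) ∧
      (∀ z ∉ ball a (dist a b), fderiv ℝ u z = 0) ∧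
      ∃ C : ENNReal, C ≠ ⊤ ∧ ∀ z, ‖fderiv ℝ u z‖ₑ ≤ C := by
  have hd : 0 < dist a b := dist_pos.2 hab
  let u : ContDiffBump a := ⟨dist a b / 3, dist a b / 2, by positivity, by linarith⟩
  have hsupp {z : ℂ} (hz : dist a b / 2 < dist z a) : z ∉ tsupport u := by
    rw [u.tsupport_eq, mem_closedBall]
    exact not_le.2 hz
  have hu : ContDiff ℝ 1 u := u.contDiff
  refine ⟨u, hu, u.eventuallyEq_one, ?_, fun z hz ↦ ?_, ?_⟩
  · refine notMem_tsupport_iff_eventuallyEq.1 (hsupp ?_)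
    rw [dist_comm b a]
    linarith
  · rw [mem_ball, not_lt] at hz
    exact (notMem_tsupport_iff_eventuallyEq.1 (hsupp (by linarith))).fderiv_eq.trans
      (by simp)
  · obtain ⟨C, hC⟩ := (hu.continuous_fderiv one_ne_zero).bounded_above_of_compact_support
      (u.hasCompactSupport.fderiv ℝ)
    refine ⟨ENNReal.ofReal C, ENNReal.ofReal_ne_top, fun z ↦ ?_⟩
    rw [← ofReal_norm]
    exact ENNReal.ofReal_le_ofReal (hC z)

/-- Limits of the Riemann map along Jordan arcs ending at two distinct
accessible boundary points are distinct. -/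
theorem arc_limits_distinct (G : Set ℂ) (φ : ℂ → ℂ) (a b : ℂ) (J₁ J₂ : Set ℂ)
    (hG : IsSCDomain G) (hφ : IsRiemannMap G φ) (hab : a ≠ b)
    (ha : a ∈ accessiblePts G) (hb : b ∈ accessiblePts G)
    (hJ₁ : IsJordanArc J₁) (hJ₁G : J₁ ⊆ closure G) (hJ₁a : J₁ ∩ frontier G = {a})
    (hJ₂ : IsJordanArc J₂) (hJ₂G : J₂ ⊆ closure G) (hJ₂b : J₂ ∩ frontier G = {b})
    (w₁ w₂ : ℂ)
    (hw₁ : Filter.Tendsto φ (𝓝[J₁ \ {a}] a) (𝓝 w₁))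
    (hw₂ : Filter.Tendsto φ (𝓝[J₂ \ {b}] b) (𝓝 w₂)) :
    w₁ ≠ w₂ := by
  rintro rfl
  have hGo : IsOpen G := hG.1
  have hsub {J : Set ℂ} {c : ℂ} (hJ : J ⊆ closure G) (hc : J ∩ frontier G = {c}) :
      J \ {c} ⊆ G := by
    rintro z ⟨hzJ, hzc⟩
    by_contra hzG
    exact hzc (hc ▸ ⟨hzJ, hGo.frontier_eq ▸ ⟨hJ hzJ, hzG⟩⟩)
  have haJ : a ∈ J₁ := (hJ₁a ▸ mem_singleton a : a ∈ J₁ ∩ frontier G).1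
  have hbJ : b ∈ J₂ := (hJ₂b ▸ mem_singleton b : b ∈ J₂ ∩ frontier G).1
  have haG : a ∉ G := fun h ↦ (hGo.frontier_eq ▸ ha.1 : a ∈ closure G \ G).2 h
  obtain ⟨g, -, -, hg⟩ := hJ₁.exists_path_tendsto haJ
  have := hg.neBot
  have hw1 : ‖w₁‖ = 1 := hφ.norm_eq_one_of_tendsto hGo (hsub hJ₁G hJ₁a) haG hw₁
  have hw : w₁ ≠ 0 := norm_ne_zero_iff.1 (by simp [hw1])
  set F : ℂ → ℂ := fun z ↦ 1 - φ z / w₁ with hF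
  have hFball : ∀ z ∈ G, F z ∈ ball (1 : ℂ) 1 := fun z hz ↦ by
    have : φ z ∈ ball (0 : ℂ) 1 := hφ.2.2 ▸ mem_image_of_mem φ hz
    rw [mem_ball_zero_iff] at this
    simpa [hF, mem_ball_iff_norm, hw1] using this
  have hFsurj : ∀ v ∈ ball (1 : ℂ) 1, ∃ z ∈ G, F z = v := fun v hv ↦ by
    have : w₁ * (1 - v) ∈ φ '' G := by
      rw [hφ.2.2, mem_ball_zero_iff, norm_mul, hw1, one_mul]
      rwa [mem_ball_iff_norm'] at hv
    obtain ⟨z, hz, hzv⟩ := this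
    exact ⟨z, hz, by simp [hF, hzv, hw]⟩
  have hre : ∀ v ∈ ball (1 : ℂ) 1, 0 < v.re := fun v hv ↦ by
    have := (Complex.abs_re_le_norm (v - 1)).trans_lt (mem_ball_iff_norm.1 hv)
    rw [abs_lt, Complex.sub_re, Complex.one_re] at this
    linarith
  have hF0 : ∀ z ∈ G, F z ≠ 0 := fun z hz h ↦ by simpa [h] using hre _ (hFball z hz)
  set L : ℂ → ℂ := fun z ↦ Complex.log (F z) with hL
  have hexpL : ∀ z ∈ G, Complex.exp (L z) = F z := fun z hz ↦ Complex.exp_log (hF0 z hz)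
  have hLan : AnalyticOnNhd ℂ L G := fun z hz ↦
    (analyticAt_const.sub ((hφ.1 z hz).div_const)).clog (Or.inl (hre _ (hFball z hz)))
  have hLinj : InjOn L G := fun z hz z' hz' h ↦ hφ.2.1 hz hz' <| by
    have h' : F z = F z' := by rw [← hexpL z hz, ← hexpL z' hz', h]
    simpa [hF, div_left_inj' hw] using h'
  have him : ∀ ζ ∈ L '' G, |ζ.im| ≤ Real.pi / 2 := by
    rintro _ ⟨z, hz, rfl⟩
    rw [hL, Complex.log_im]
    exact Complex.abs_arg_le_pi_div_two_iff.2 (hre _ (hFball z hz)).le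
  have hSo : IsOpen (L '' G) := isOpen_iff_mem_nhds.2 <| by
    rintro _ ⟨z, hz, rfl⟩
    rw [← hLan.map_nhds_of_injOn hGo hLinj hz]
    exact image_mem_map (hGo.mem_nhds hz)
  have hmemS {ζ : ℂ} (hi : |ζ.im| ≤ Real.pi / 2) (he : Complex.exp ζ ∈ ball (1 : ℂ) 1) :
      ζ ∈ L '' G := by
    obtain ⟨z, hz, hzv⟩ := hFsurj _ he
    rw [abs_le] at hi
    have := Real.pi_pos
    exact ⟨z, hz, by
      simp only [hL, hzv, Complex.log_exp (show -Real.pi < ζ.im by linarith) (by linarith)]⟩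
  have hψ := hLinj.leftInvOn_invFunOn
  set ψ := Function.invFunOn L G
  have hψinj : InjOn ψ (L '' G) := by
    rintro _ ⟨z, hz, rfl⟩ _ ⟨z', hz', rfl⟩ h
    rw [show z = z' by rwa [hψ hz, hψ hz'] at h]
  have hψd : DifferentiableOn ℂ ψ (L '' G) := by
    rintro _ ⟨z, hz, rfl⟩
    exact (hLan.differentiableAt_leftInverse hGo hLinj hψ hz).differentiableWithinAt
  have hlim {J : Set ℂ} {c : ℂ} (hJ : J \ {c} ⊆ G) (hc : Tendsto φ (𝓝[J \ {c}] c) (𝓝 w₁)) :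
      Tendsto (fun z ↦ (L z).re) (𝓝[J \ {c}] c) atBot := by
    simp only [hL, Complex.log_re]
    refine Real.tendsto_log_nhdsGT_zero.comp (tendsto_nhdsWithin_iff.2 ⟨?_, ?_⟩)
    · have : Tendsto F (𝓝[J \ {c}] c) (𝓝 0) := by
        simpa [hF, hw] using (hc.div_const w₁).const_sub 1
      simpa using this.norm
    · filter_upwards [self_mem_nhdsWithin] with z hz
      exact norm_pos_iff.2 (hF0 z (hJ hz))
  have hLre : ContinuousOn (fun z ↦ (L z).re) G :=
    Complex.continuous_re.comp_continuousOn hLan.continuousOn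
  obtain ⟨u, hu, hua, hub, huB, C, hC, huC⟩ := exists_contDiff_eq_one_eq_zero hab
  obtain ⟨M₁, hM₁⟩ := hJ₁.exists_forall_le_exists_eq haJ (hsub hJ₁G hJ₁a) hLre
    (hlim (hsub hJ₁G hJ₁a) hw₁) hua
  obtain ⟨M₂, hM₂⟩ := hJ₂.exists_forall_le_exists_eq hbJ (hsub hJ₂G hJ₂b) hLre
    (hlim (hsub hJ₂G hJ₂b) hw₂) hub
  refine not_forall_exists_vertical_segment hSo him hψd hψinj hu huC hC isOpen_ball
    measure_ball_lt_top.ne huB (min M₁ M₂) fun x hx ↦ ?_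
  obtain ⟨z₁, ⟨hz₁, hu₁⟩, rfl⟩ := hM₁ x (hx.trans (min_le_left _ _))
  obtain ⟨z₂, ⟨hz₂, hu₂⟩, hx₂⟩ := hM₂ _ (hx.trans (min_le_right _ _))
  have e₁ : (((L z₁).re : ℂ) + (L z₁).im * Complex.I) = L z₁ := Complex.re_add_im _
  have e₂ : (((L z₁).re : ℂ) + (L z₂).im * Complex.I) = L z₂ := by
    rw [← hx₂]
    exact Complex.re_add_im _
  have i₁ := him _ (mem_image_of_mem L hz₁)
  have i₂ := him _ (mem_image_of_mem L hz₂)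
  refine ⟨(L z₂).im, (L z₁).im, fun y hy ↦ hmemS ?_ ?_, ?_⟩
  · have : y ∈ Icc (-(Real.pi / 2)) (Real.pi / 2) :=
      uIcc_subset_Icc (abs_le.1 i₂) (abs_le.1 i₁) hy
    simpa [abs_le] using this
  · refine exp_vertical_segment_mem_ball i₂ i₁ ?_ ?_ hy
    · rw [e₂, hexpL z₂ hz₂]
      exact hFball z₂ hz₂
    · rw [e₁, hexpL z₁ hz₁]
      exact hFball z₁ hz₁
  · rw [e₁, e₂, hψ hz₁, hψ hz₂, show u z₁ = 1 from hu₁, show u z₂ = 0 from hu₂]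
    simp
end

section
/- Let φ be a Riemann map of a simply connected domain G in ℂ and suppose φ has a continuous extension Φ to closure(G). Then Φ is injective on the set of accessible boundary points of G. -/
open Set Topology Metric Filter

section

open MeasureTheory Complex Interval

theorem AnalyticOnNhd.nhds_le_map_of_injOn {G : Set ℂ} {φ : ℂ → ℂ} (hG : IsOpen G)
    (hφ : AnalyticOnNhd ℂ φ G) (hinj : InjOn φ G) {x : ℂ} (hx : x ∈ G) :
    𝓝 (φ x) ≤ map φ (𝓝 x) := by
  refine (hφ x hx).eventually_constant_or_nhds_le_map_nhds_aux.resolve_left fun h => ?_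
  have h1 : ∀ᶠ z in 𝓝 x, z = x := by
    filter_upwards [h, hG.mem_nhds hx] with z hz hzG using hinj hzG hx hz
  obtain ⟨z, hz, hz'⟩ :=
    ((h1.filter_mono nhdsWithin_le_nhds).and (self_mem_nhdsWithin (a := x) (s := {x}ᶜ))).exists
  exact hz' hz

theorem AnalyticOnNhd.tendsto_invFunOn {G : Set ℂ} {φ : ℂ → ℂ} (hG : IsOpen G)
    (hφ : AnalyticOnNhd ℂ φ G) (hinj : InjOn φ G) {x : ℂ} (hx : x ∈ G) :
    Tendsto (Function.invFunOn φ G) (𝓝 (φ x)) (𝓝 x) := by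
  have h : Function.invFunOn φ G ∘ φ =ᶠ[𝓝 x] id := by
    filter_upwards [hG.mem_nhds hx] with z hz using hinj.leftInvOn_invFunOn hz
  calc map (Function.invFunOn φ G) (𝓝 (φ x))
      ≤ map (Function.invFunOn φ G) (map φ (𝓝 x)) :=
        map_mono (hφ.nhds_le_map_of_injOn hG hinj hx)
    _ = 𝓝 x := by rw [map_map, map_congr h, map_id]

theorem AnalyticOnNhd.differentiableOn_invFunOn {G : Set ℂ} {φ : ℂ → ℂ} (hG : IsOpen G)
    (hφ : AnalyticOnNhd ℂ φ G) (hinj : InjOn φ G) :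
    DifferentiableOn ℂ (Function.invFunOn φ G) (φ '' G) := by
  rintro _ ⟨x, hx, rfl⟩
  have hinv : ∀ y ∈ G, Function.invFunOn φ G (φ y) = y := fun y hy => hinj.leftInvOn_invFunOn hy
  have hderiv : ∀ᶠ z in 𝓝[≠] x, deriv φ z ≠ 0 := by
    refine (hφ x hx).deriv.eventually_eq_zero_or_eventually_ne_zero.resolve_left fun h => ?_
    obtain ⟨r, hr, hball⟩ := Metric.eventually_nhds_iff_ball.1 (h.and (hG.mem_nhds hx))
    have hconst : ∀ z ∈ ball x r, φ z = φ x := fun z hz =>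
      isOpen_ball.is_const_of_deriv_eq_zero (convex_ball x r).isPreconnected
        (fun y hy => (hφ y (hball y hy).2).differentiableAt.differentiableWithinAt)
        (fun y hy => (hball y hy).1) hz (mem_ball_self hr)
    have h1 : ∀ᶠ z in 𝓝 x, z = x := by
      filter_upwards [ball_mem_nhds x hr] with z hz
      exact hinj (hball z hz).2 hx (hconst z hz)
    obtain ⟨z, hz, hz'⟩ :=
      ((h1.filter_mono nhdsWithin_le_nhds).and (self_mem_nhdsWithin (a := x) (s := {x}ᶜ))).exists
    exact hz' hz
  refine (analyticAt_of_differentiable_on_punctured_nhds_of_continuousAt ?_ ?_).differentiableAt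
    |>.differentiableWithinAt
  · rw [eventually_nhdsWithin_iff] at hderiv ⊢
    refine hφ.nhds_le_map_of_injOn hG hinj hx (mem_map.2 ?_)
    filter_upwards [hderiv, hG.mem_nhds hx] with z hz hzG hne
    have hzx : z ≠ x := fun h => hne (by rw [h]; rfl)
    have hz' := hz hzx
    refine (HasDerivAt.of_local_left_inverse (f := φ) (f' := deriv φ z) ?_ ?_ hz' ?_).differentiableAt
    · simpa [ContinuousAt, hinv z hzG] using hφ.tendsto_invFunOn hG hinj hzG
    · rw [hinv z hzG]
      exact (hφ z hzG).differentiableAt.hasDerivAt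
    · refine hφ.nhds_le_map_of_injOn hG hinj hzG (mem_map.2 ?_)
      filter_upwards [hG.mem_nhds hzG] with y hy
      simp [hinv y hy]
  · simpa [ContinuousAt, hinv x hx] using hφ.tendsto_invFunOn hG hinj hx

theorem lintegral_comp_mul_enorm_deriv_sq {Ω : Set ℂ} {F : ℂ → ℂ} (hΩ : IsOpen Ω)
    (hF : DifferentiableOn ℂ F Ω) (hinj : InjOn F Ω) (g : ℂ → ENNReal) :
    ∫⁻ ζ in Ω, g (F ζ) * ‖deriv F ζ‖ₑ ^ 2 = ∫⁻ z in F '' Ω, g z := by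
  have hdet : ∀ c : ℂ, ((ContinuousLinearMap.toSpanSingleton ℂ c).restrictScalars ℝ).det
      = ‖c‖ ^ 2 := by
    intro c
    have h := congrArg (fun f => f c) Algebra.norm_complex_eq
    simp only [Algebra.norm_apply] at h
    rw [← Complex.normSq_eq_norm_sq]
    refine Eq.trans ?_ h
    rw [ContinuousLinearMap.det]
    congr 1
    ext
    simp [mul_comm]
  rw [lintegral_image_eq_lintegral_abs_det_fderiv_mul volume hΩ.measurableSet
    (fun ζ hζ => (((hF.differentiableAt (hΩ.mem_nhds hζ)).hasDerivAt.hasFDerivAt).restrictScalars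
      ℝ).hasFDerivWithinAt) hinj g]
  refine setLIntegral_congr_fun hΩ.measurableSet fun ζ _ => ?_
  simp only [hdet]
  rw [mul_comm, abs_of_nonneg (by positivity), ENNReal.ofReal_pow (norm_nonneg _),
    ofReal_norm]

theorem ENNReal.le_four_mul_sq_add (x : ENNReal) : x ≤ 4 * x ^ 2 + 16⁻¹ := by
  induction x with
  | top => simp
  | coe x =>
    have : x ≤ 4 * x ^ 2 + 16⁻¹ := by
      rw [← NNReal.coe_le_coe]
      push_cast
      nlinarith [sq_nonneg ((x : ℝ) - 1 / 8)]
    calc (x : ENNReal) ≤ ((4 * x ^ 2 + 16⁻¹ : NNReal) : ENNReal) := by exact_mod_cast this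
      _ = _ := by rw [ENNReal.coe_add, ENNReal.coe_inv (by norm_num)]; push_cast; rfl

theorem le_lintegral_slice {Ω : Set ℂ} {F : ℂ → ℂ} {χ : ℂ → ℝ} (hΩ : IsOpen Ω)
    (hF : DifferentiableOn ℂ F Ω) (hχ : ContDiff ℝ 1 χ) {s θ₁ θ₂ : ℝ}
    (hlen : |θ₂ - θ₁| ≤ 4) (hmem : ∀ θ ∈ uIcc θ₁ θ₂, (s + θ * I : ℂ) ∈ Ω)
    (hsep : 1 / 2 ≤ |χ (F (s + θ₂ * I)) - χ (F (s + θ₁ * I))|) :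
    16⁻¹ ≤ ∫⁻ θ in uIcc θ₁ θ₂, ‖fderiv ℝ χ (F (s + θ * I))‖ₑ ^ 2 * ‖deriv F (s + θ * I)‖ₑ ^ 2 := by
  let h' : ℝ → ℝ := fun θ => fderiv ℝ χ (F (s + θ * I)) (deriv F (s + θ * I) * I)
  have hline : ∀ θ : ℝ, HasDerivAt (fun t : ℝ => (s + t * I : ℂ)) I θ := fun θ => by
    simpa using ((Complex.ofRealCLM.hasDerivAt (x := θ)).mul_const I).const_add (s : ℂ)
  have hcl : Continuous fun t : ℝ => (s + t * I : ℂ) := by fun_prop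
  have hd : ∀ θ ∈ uIcc θ₁ θ₂, HasDerivAt (fun t : ℝ => χ (F (s + t * I))) (h' θ) θ := by
    intro θ hθ
    have h1 := (hF.differentiableAt (hΩ.mem_nhds (hmem θ hθ))).hasDerivAt.comp θ (hline θ)
    exact ((hχ.differentiable one_ne_zero _).hasFDerivAt).comp_hasDerivAt θ h1
  have hFc : ContinuousOn (fun t : ℝ => F (s + t * I)) (uIcc θ₁ θ₂) :=
    hF.continuousOn.comp hcl.continuousOn hmem
  have hF'c : ContinuousOn (fun t : ℝ => deriv F (s + t * I)) (uIcc θ₁ θ₂) :=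
    (hF.deriv hΩ).continuousOn.comp hcl.continuousOn hmem
  have hc : ContinuousOn h' (uIcc θ₁ θ₂) :=
    ((hχ.continuous_fderiv one_ne_zero).comp_continuousOn hFc).clm_apply
      (hF'c.mul continuousOn_const)
  have hint := intervalIntegral.integral_eq_sub_of_hasDerivAt hd hc.intervalIntegrable
  set E := ∫⁻ θ in uIcc θ₁ θ₂,
    ‖fderiv ℝ χ (F (s + θ * I))‖ₑ ^ 2 * ‖deriv F (s + θ * I)‖ₑ ^ 2 with hE
  have hle : (2⁻¹ : ENNReal) ≤ 4 * E + 4⁻¹ := by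
    calc (2⁻¹ : ENNReal) = ENNReal.ofReal (1 / 2) := by
          rw [one_div, ENNReal.ofReal_inv_of_pos (by norm_num)]; simp
      _ ≤ ENNReal.ofReal |χ (F (s + θ₂ * I)) - χ (F (s + θ₁ * I))| := ENNReal.ofReal_le_ofReal hsep
      _ = ENNReal.ofReal ‖∫ θ in Ι θ₁ θ₂, h' θ‖ := by
          rw [← intervalIntegral.norm_intervalIntegral_eq, hint, Real.norm_eq_abs]
      _ ≤ ∫⁻ θ in Ι θ₁ θ₂, ‖h' θ‖ₑ := by
          rw [ofReal_norm]; exact enorm_integral_le_lintegral_enorm _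
      _ ≤ ∫⁻ θ in uIcc θ₁ θ₂, ‖h' θ‖ₑ := lintegral_mono_set uIoc_subset_uIcc
      _ ≤ ∫⁻ θ in uIcc θ₁ θ₂, (4 * (‖fderiv ℝ χ (F (s + θ * I))‖ₑ ^ 2 *
            ‖deriv F (s + θ * I)‖ₑ ^ 2) + 16⁻¹) := by
          refine lintegral_mono fun θ => (ENNReal.le_four_mul_sq_add _).trans ?_
          gcongr
          rw [← mul_pow]
          gcongr
          refine (ContinuousLinearMap.le_opENorm _ _).trans_eq ?_
          rw [enorm_mul, show ‖I‖ₑ = 1 by rw [← ofReal_norm]; simp, mul_one]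
      _ = 4 * E + 16⁻¹ * volume (uIcc θ₁ θ₂) := by
          rw [lintegral_add_right _ measurable_const, lintegral_const_mul' _ _ (by simp), setLIntegral_const]
      _ ≤ 4 * E + 16⁻¹ * 4 := by
          gcongr
          rw [uIcc, Real.volume_Icc, max_sub_min_eq_abs]
          exact (ENNReal.ofReal_le_ofReal hlen).trans_eq (by simp)
      _ = 4 * E + 4⁻¹ := by
          congr 1
          rw [show (16 : ENNReal) = 4 * 4 by norm_num, ENNReal.mul_inv (by simp) (by simp),
            mul_assoc, ENNReal.inv_mul_cancel (by simp) (by simp), mul_one]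
  by_contra! hlt
  have hE' : E ≠ ⊤ := hlt.ne_top
  clear_value E
  lift E to NNReal using hE'
  have h1 : ((2⁻¹ : NNReal) : ENNReal) ≤ ((4 * E + 4⁻¹ : NNReal) : ENNReal) := by
    push_cast [ENNReal.coe_inv]
    exact hle
  have h2 : (E : ENNReal) < ((16⁻¹ : NNReal) : ENNReal) := by
    rw [ENNReal.coe_inv (by norm_num)]
    exact hlt
  rw [ENNReal.coe_le_coe, ← NNReal.coe_le_coe] at h1
  rw [ENNReal.coe_lt_coe, ← NNReal.coe_lt_coe] at h2
  push_cast at h1 h2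
  linarith

theorem lintegral_enorm_fderiv_sq_lt_top {χ : ℂ → ℝ} (hχ : ContDiff ℝ 1 χ)
    (hsupp : HasCompactSupport χ) : ∫⁻ z, ‖fderiv ℝ χ z‖ₑ ^ 2 < ⊤ := by
  have hi : Integrable fun z => ‖fderiv ℝ χ z‖ ^ 2 := by
    refine ((hχ.continuous_fderiv one_ne_zero).norm.pow 2).integrable_of_hasCompactSupport ?_
    refine (hsupp.fderiv ℝ).mono fun z hz h0 => hz ?_
    simp [h0]
  have h := hi.2
  simpa only [HasFiniteIntegral, enorm_pow, enorm_norm] using h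

/-- Length-area principle: if `F` is univalent on a domain of bounded height whose vertical slices
are intervals, then a compactly supported `C¹` function of `F` has small oscillation on vertical
slices arbitrarily far to the left. -/
theorem exists_slice_close {Ω : Set ℂ} {F : ℂ → ℂ} {χ : ℂ → ℝ} (hΩ : IsOpen Ω)
    (hF : DifferentiableOn ℂ F Ω) (hinj : InjOn F Ω) (hχ : ContDiff ℝ 1 χ)
    (hsupp : HasCompactSupport χ) (hbd : ∀ ζ ∈ Ω, |ζ.im| ≤ 2)
    (hord : ∀ s : ℝ, OrdConnected {θ : ℝ | (s + θ * I : ℂ) ∈ Ω}) (s₀ : ℝ) :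
    ∃ s < s₀, ∀ ζ₁ ∈ Ω, ∀ ζ₂ ∈ Ω, ζ₁.re = s → ζ₂.re = s → |χ (F ζ₂) - χ (F ζ₁)| < 1 / 2 := by
  by_contra! hcon
  set g : ℂ → ENNReal := fun z => ‖fderiv ℝ χ z‖ₑ ^ 2 with hg
  set H : ℂ → ENNReal := Ω.indicator fun ζ => g (F ζ) * ‖deriv F ζ‖ₑ ^ 2 with hH
  have hgc : Continuous fun z => fderiv ℝ χ z := hχ.continuous_fderiv one_ne_zero
  have hfin : ∫⁻ ζ, H ζ < ⊤ := by
    rw [hH, lintegral_indicator hΩ.measurableSet, lintegral_comp_mul_enorm_deriv_sq hΩ hF hinj]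
    exact (setLIntegral_le_lintegral _ _).trans_lt (lintegral_enorm_fderiv_sq_lt_top hχ hsupp)
  have hHm : AEMeasurable H := by
    refine (aemeasurable_indicator_iff hΩ.measurableSet).2 (.fun_mul ?_ ?_)
    · exact ((hgc.comp_continuousOn hF.continuousOn).aemeasurable hΩ.measurableSet).enorm.pow_const 2
    · exact ((measurable_deriv F).enorm.pow_const 2).aemeasurable
  have hprod : ∫⁻ ζ, H ζ = ∫⁻ s : ℝ, ∫⁻ θ : ℝ, H (s + θ * I) := by
    rw [← Complex.volume_preserving_equiv_real_prod.symm.lintegral_comp_emb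
      (MeasurableEquiv.measurableEmbedding _), Measure.volume_eq_prod, lintegral_prod]
    · refine lintegral_congr fun s => lintegral_congr fun θ => ?_
      congr 1
      apply Complex.ext <;> simp
    · exact hHm.comp_quasiMeasurePreserving
        Complex.volume_preserving_equiv_real_prod.symm.quasiMeasurePreserving
  have hslice : ∀ s ∈ Iio s₀, 16⁻¹ ≤ ∫⁻ θ : ℝ, H (s + θ * I) := by
    intro s hs
    obtain ⟨ζ₁, h₁, ζ₂, h₂, hs₁, hs₂, hsep⟩ := hcon s hs
    have e₁ : (s + ζ₁.im * I : ℂ) = ζ₁ := by rw [← hs₁, Complex.re_add_im]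
    have e₂ : (s + ζ₂.im * I : ℂ) = ζ₂ := by rw [← hs₂, Complex.re_add_im]
    have hmem : ∀ θ ∈ uIcc ζ₁.im ζ₂.im, (s + θ * I : ℂ) ∈ Ω := fun θ hθ =>
      (hord s).uIcc_subset (by simpa [e₁] using h₁) (by simpa [e₂] using h₂) hθ
    refine (le_lintegral_slice hΩ hF hχ ?_ hmem (by rwa [e₁, e₂])).trans ?_
    · have := abs_le.1 (hbd _ h₁)
      have := abs_le.1 (hbd _ h₂)
      rw [abs_le]
      constructor <;> linarith
    · refine le_trans (le_of_eq ?_) (setLIntegral_le_lintegral (uIcc ζ₁.im ζ₂.im) _)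
      refine setLIntegral_congr_fun measurableSet_uIcc fun θ hθ => ?_
      simp only [hH, indicator_of_mem (hmem θ hθ), hg]
  refine hfin.ne (top_le_iff.1 ?_)
  calc (⊤ : ENNReal) = ∫⁻ _ in Iio s₀, (16⁻¹ : ENNReal) := by simp [ENNReal.mul_top]
    _ ≤ ∫⁻ s in Iio s₀, ∫⁻ θ : ℝ, H (s + θ * I) := setLIntegral_mono' measurableSet_Iio hslice
    _ ≤ ∫⁻ s : ℝ, ∫⁻ θ : ℝ, H (s + θ * I) := setLIntegral_le_lintegral _ _
    _ = ∫⁻ ζ, H ζ := hprod.symm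

/-- Near an accessible point `b`, the map `φ` takes values at every small distance from `Φ b`. -/
theorem exists_mem_norm_sub_eq {G : Set ℂ} {φ Φ : ℂ → ℂ} {b : ℂ} {U : Set ℂ} (hG : IsOpen G)
    (hΦ : IsContExtension G φ Φ) (hb : b ∈ accessiblePts G) (hne : ∀ x ∈ G, φ x ≠ Φ b)
    (hU : U ∈ 𝓝 b) :
    ∃ r₀ > 0, ∀ r, 0 < r → r < r₀ → ∃ x ∈ G ∩ U, ‖φ x - Φ b‖ = r := by
  obtain ⟨-, J, ⟨f, hf, hinj, rfl⟩, hJ, hJb⟩ := hb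
  obtain ⟨⟨t₀, ht₀, rfl⟩, -⟩ : b ∈ f '' Icc 0 1 ∩ frontier G := hJb ▸ mem_singleton b
  have hmem : ∀ t ∈ Icc (0 : ℝ) 1, t ≠ t₀ → f t ∈ G := by
    intro t ht hne
    by_contra hfG
    have h : f t ∈ f '' Icc 0 1 ∩ frontier G :=
      ⟨mem_image_of_mem f ht, hJ (mem_image_of_mem f ht), by rwa [hG.interior_eq]⟩
    rw [hJb] at h
    exact hne (hinj ht ht₀ h)
  obtain ⟨ε, hε, hεU⟩ := Metric.mem_nhdsWithin_iff.1 (hf t₀ ht₀ hU)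
  obtain ⟨t₁, ht₁, ht₁ne, ht₁ε⟩ : ∃ t₁ ∈ Icc (0 : ℝ) 1, t₁ ≠ t₀ ∧ |t₁ - t₀| < ε := by
    have hδ : 0 < min (ε / 2) (1 / 2) := by positivity
    have hδ₁ := min_le_left (ε / 2) (1 / 2)
    have hδ₂ := min_le_right (ε / 2) (1 / 2)
    obtain ⟨h0, h1⟩ := ht₀
    rcases le_total t₀ (1 / 2) with h | h
    · refine ⟨t₀ + min (ε / 2) (1 / 2), ⟨by linarith, by linarith⟩, by linarith, ?_⟩
      rw [add_sub_cancel_left, abs_of_pos hδ]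
      linarith
    · refine ⟨t₀ - min (ε / 2) (1 / 2), ⟨by linarith, by linarith⟩, by linarith, ?_⟩
      rw [sub_sub_cancel_left, abs_neg, abs_of_pos hδ]
      linarith
  have hsub : uIcc t₀ t₁ ⊆ Icc 0 1 := ordConnected_Icc.uIcc_subset ht₀ ht₁
  have hclos : MapsTo f (uIcc t₀ t₁) (closure G) := fun t ht => hJ (mem_image_of_mem f (hsub ht))
  have hcont : ContinuousOn (fun t => ‖Φ (f t) - Φ (f t₀)‖) (uIcc t₀ t₁) :=
    ((hΦ.1.comp (hf.mono hsub) hclos).sub continuousOn_const).norm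
  refine ⟨‖Φ (f t₁) - Φ (f t₀)‖, ?_, fun r hr hr₁ => ?_⟩
  · rw [gt_iff_lt, norm_pos_iff, sub_ne_zero, hΦ.2 (hmem t₁ ht₁ ht₁ne)]
    exact hne _ (hmem t₁ ht₁ ht₁ne)
  · obtain ⟨t, ht, htr⟩ := intermediate_value_uIcc hcont
      (show r ∈ uIcc _ _ by
        simp only [sub_self, norm_zero]
        rw [uIcc_of_le (norm_nonneg _)]
        exact ⟨hr.le, hr₁.le⟩)
    have htne : t ≠ t₀ := by
      rintro rfl
      simp only [sub_self, norm_zero] at htr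
      exact hr.ne htr
    have htG := hmem t (hsub ht) htne
    refine ⟨f t, ⟨htG, hεU ⟨?_, hsub ht⟩⟩, (congrArg (fun z => ‖z - Φ (f t₀)‖) (hΦ.2 htG)).symm.trans htr⟩
    rw [mem_ball, Real.dist_eq]
    exact (abs_sub_left_of_mem_uIcc ht).trans_lt ht₁ε

theorem norm_extension_eq_one {G : Set ℂ} {φ Φ : ℂ → ℂ} {b : ℂ} (hG : IsOpen G)
    (hφ : IsRiemannMap G φ) (hΦ : IsContExtension G φ Φ) (hb : b ∈ frontier G) : ‖Φ b‖ = 1 := by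
  have : (𝓝[G] b).NeBot := mem_closure_iff_nhdsWithin_neBot.1 hb.1
  have hbG : b ∉ G := by
    have := hb.2
    rwa [hG.interior_eq] at this
  have hlim : Tendsto φ (𝓝[G] b) (𝓝 (Φ b)) := by
    refine ((hΦ.1 b hb.1).mono_left (nhdsWithin_mono b subset_closure)).congr' ?_
    filter_upwards [self_mem_nhdsWithin] with x hx using hΦ.2 hx
  have hball : ∀ x ∈ G, φ x ∈ ball (0 : ℂ) 1 := fun x hx => hφ.2.2 ▸ mem_image_of_mem φ hx
  refine le_antisymm (le_of_tendsto hlim.norm ?_) ?_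
  · filter_upwards [self_mem_nhdsWithin] with x hx
    exact (mem_ball_zero_iff.1 (hball x hx)).le
  · by_contra! hlt
    obtain ⟨x, hx, hxb⟩ : Φ b ∈ φ '' G := by
      rw [hφ.2.2]
      simpa using hlt
    have h := (hφ.1.tendsto_invFunOn hG hφ.2.1 hx).comp (hxb ▸ hlim)
    have h' : Tendsto id (𝓝[G] b) (𝓝 x) := by
      refine h.congr' ?_
      filter_upwards [self_mem_nhdsWithin] with y hy using hφ.2.1.leftInvOn_invFunOn hy
    have := tendsto_nhds_unique h' (tendsto_id.mono_left nhdsWithin_le_nhds)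
    exact hbG (this ▸ hx)

/-- The domain mapped bijectively onto the disc `ball 1 1` by `exp`. -/
def logDisk : Set ℂ := {ζ | |ζ.im| < Real.pi / 2 ∧ ‖1 - exp ζ‖ < 1}

theorem isOpen_logDisk : IsOpen logDisk := by
  have h₁ : IsOpen {ζ : ℂ | |ζ.im| < Real.pi / 2} := isOpen_lt (by fun_prop) continuous_const
  have h₂ : IsOpen {ζ : ℂ | ‖1 - exp ζ‖ < 1} := isOpen_lt (by fun_prop) continuous_const
  exact h₁.inter h₂

theorem mk_mem_logDisk_iff {s θ : ℝ} :
    (s + θ * I : ℂ) ∈ logDisk ↔ |θ| < Real.pi / 2 ∧ Real.exp s / 2 < Real.cos θ := by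
  have h : ‖1 - exp (s + θ * I)‖ ^ 2 = 1 - Real.exp s * (2 * Real.cos θ - Real.exp s) := by
    rw [← normSq_eq_norm_sq, normSq_apply]
    simp only [sub_re, sub_im, one_re, one_im, exp_re, exp_im, add_re, add_im, mul_re, mul_im,
      ofReal_re, ofReal_im, I_re, I_im]
    ring_nf
    linear_combination Real.exp s ^ 2 * Real.sin_sq_add_cos_sq θ
  have h1 : ‖1 - exp (s + θ * I)‖ < 1 ↔ Real.exp s / 2 < Real.cos θ := by
    rw [← sq_lt_one_iff₀ (norm_nonneg _), h, sub_lt_self_iff,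
      mul_pos_iff_of_pos_left (Real.exp_pos s)]
    constructor <;> intro <;> linarith
  simp only [logDisk, mem_ofPred_eq, h1]
  simp

theorem ordConnected_logDisk_slice (s : ℝ) : OrdConnected {θ : ℝ | (s + θ * I : ℂ) ∈ logDisk} := by
  have h := (strictConcaveOn_cos_Icc.concaveOn.subset Ioo_subset_Icc_self
    (convex_Ioo (-(Real.pi / 2)) (Real.pi / 2))).convex_gt (Real.exp s / 2)
  have heq : {θ : ℝ | (s + θ * I : ℂ) ∈ logDisk} =
      {θ | θ ∈ Ioo (-(Real.pi / 2)) (Real.pi / 2) ∧ Real.exp s / 2 < Real.cos θ} :=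
    Set.ext fun θ => by simp only [mem_ofPred_eq, mk_mem_logDisk_iff, abs_lt, mem_Ioo]
  exact heq ▸ h.ordConnected

theorem log_mem_logDisk {z : ℂ} (hz : ‖z‖ < 1) :
    log (1 - z) ∈ logDisk ∧ exp (log (1 - z)) = 1 - z := by
  have hre : 0 < (1 - z).re := by
    have := (re_le_norm z).trans_lt hz
    simpa using this
  have hexp : exp (log (1 - z)) = 1 - z := exp_log fun h => by simp [h] at hre
  refine ⟨⟨?_, by rwa [hexp, sub_sub_cancel]⟩, hexp⟩
  rw [log_im]
  exact abs_arg_lt_pi_div_two_iff.2 (Or.inl hre)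

theorem injOn_exp_logDisk : InjOn exp logDisk := by
  have h : ∀ ζ ∈ logDisk, log (exp ζ) = ζ := by
    intro ζ hζ
    have := abs_lt.1 hζ.1
    have := Real.pi_pos
    exact log_exp (by linarith) (by linarith)
  intro x hx y hy hxy
  rw [← h x hx, ← h y hy, hxy]

end

/-- A continuous extension of the Riemann map is injective on the set of
accessible boundary points. -/
theorem ext_injective_on_accessible (G : Set ℂ) (φ Φ : ℂ → ℂ)
    (hG : IsSCDomain G) (hφ : IsRiemannMap G φ) (hΦ : IsContExtension G φ Φ) :
    Set.InjOn Φ (accessiblePts G) := by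
  intro a ha b hb hab
  by_contra hne
  obtain ⟨hGo, -⟩ := hG
  obtain ⟨w, hw⟩ : ∃ w, w = Φ a := ⟨_, rfl⟩
  have hw1 : ‖w‖ = 1 := hw ▸ norm_extension_eq_one hGo hφ hΦ ha.1
  have hw0 : w ≠ 0 := norm_ne_zero_iff.1 (by simp [hw1])
  have hball : ∀ x ∈ G, ‖φ x‖ < 1 := fun x hx =>
    mem_ball_zero_iff.1 (hφ.2.2 ▸ mem_image_of_mem φ hx)
  have hφw : ∀ x ∈ G, φ x ≠ w := fun x hx h => (hball x hx).ne (h ▸ hw1)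
  obtain ⟨χ, hχs, hχc, hχd, -, hχa⟩ :=
    exists_contDiff_tsupport_subset (n := 1) (isOpen_compl_singleton.mem_nhds hne)
  have hχb : χ b = 0 := image_eq_zero_of_notMem_tsupport fun h => hχs h rfl
  obtain ⟨ra, hra, hA⟩ := exists_mem_norm_sub_eq (U := {x | 3 / 4 < χ x}) hGo hΦ ha
    (hw ▸ hφw) ((isOpen_lt continuous_const hχd.continuous).mem_nhds (by
      rw [mem_ofPred_eq, hχa]; norm_num))
  obtain ⟨rb, hrb, hB⟩ := exists_mem_norm_sub_eq (U := {x | χ x < 1 / 4}) hGo hΦ hb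
    (hab ▸ hw ▸ hφw) ((isOpen_lt hχd.continuous continuous_const).mem_nhds (by
      rw [mem_ofPred_eq, hχb]; norm_num))
  rw [← hw] at hA
  rw [← hab, ← hw] at hB
  set F : ℂ → ℂ := fun ζ => Function.invFunOn φ G (w * (1 - Complex.exp ζ)) with hF
  have hmaps : MapsTo (fun ζ => w * (1 - Complex.exp ζ)) logDisk (φ '' G) := by
    intro ζ hζ
    rw [hφ.2.2, mem_ball_zero_iff, norm_mul, hw1, one_mul]
    exact hζ.2
  have hFd : DifferentiableOn ℂ F logDisk :=
    (hφ.1.differentiableOn_invFunOn hGo hφ.2.1).comp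
      (show Differentiable ℂ fun ζ => w * (1 - Complex.exp ζ) by fun_prop).differentiableOn hmaps
  have hFi : InjOn F logDisk := by
    intro x hx y hy hxy
    have h := Function.invFunOn_injOn_image φ G (hmaps hx) (hmaps hy) hxy
    exact injOn_exp_logDisk hx hy (sub_right_injective (mul_left_cancel₀ hw0 h))
  obtain ⟨s, hs, hclose⟩ := exists_slice_close isOpen_logDisk hFd hFi hχd hχc
    (fun ζ hζ => by linarith [hζ.1, Real.pi_le_four]) ordConnected_logDisk_slice
    (min (Real.log ra) (Real.log rb))
  have hkey : ∀ x ∈ G, ‖φ x - w‖ = Real.exp s → ∃ ζ ∈ logDisk, ζ.re = s ∧ F ζ = x := by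
    intro x hx hxs
    obtain ⟨h1, h2⟩ := log_mem_logDisk (z := φ x / w) (by simpa [hw1] using hball x hx)
    refine ⟨_, h1, ?_, ?_⟩
    · have : 1 - φ x / w = -(φ x - w) / w := by field_simp; ring
      rw [Complex.log_re, this, norm_div, norm_neg, hw1, div_one, hxs, Real.log_exp]
    · simp only [hF, h2, sub_sub_cancel]
      rw [mul_div_cancel₀ _ hw0]
      exact hφ.2.1.leftInvOn_invFunOn hx
  obtain ⟨x, ⟨hxG, hxU⟩, hxs⟩ := hA (Real.exp s) (Real.exp_pos s)
    ((Real.lt_log_iff_exp_lt hra).1 (hs.trans_le (min_le_left _ _)))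
  obtain ⟨y, ⟨hyG, hyU⟩, hys⟩ := hB (Real.exp s) (Real.exp_pos s)
    ((Real.lt_log_iff_exp_lt hrb).1 (hs.trans_le (min_le_right _ _)))
  obtain ⟨ζ₁, hζ₁, hre₁, rfl⟩ := hkey x hxG hxs
  obtain ⟨ζ₂, hζ₂, hre₂, rfl⟩ := hkey y hyG hys
  have := (abs_lt.1 (hclose ζ₁ hζ₁ ζ₂ hζ₂ hre₁ hre₂)).1
  rw [mem_ofPred_eq] at hxU hyU
  linarith
end
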